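/- arXiv:1011.2142 — 3 statements merged into one kernel-verified Lean document; each statement's English description precedes it below -/
import Mathlib

section
/- For every C > 0 there exists a constant K depending only on C such that, for every ε ∈ (0,1], every n ≥ 1, every even function f ∈ F_n(C,ε) on (ℝ^d)^n, and independent standard Gaussian vectors X₁, …, X_n on ℝ^d, one has E[e^{−f(X₁,…,X_n)}] · E[e^{Hf(X₁,…,X_n)}] ≤ (1 + K ε³)^n. -/
open MeasureTheory Real

/-- The standard Gaussian probability measure on `ℝ^d`. -/
noncomputable def stdGauss (d : ℕ) : Measure (EuclideanSpace ℝ (Fin d)) :=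
  volume.withDensity fun x =>
    ENNReal.ofReal ((2 * π) ^ (-(d : ℝ) / 2) * Real.exp (-‖x‖ ^ 2 / 2))

/-- The class `F(C,ε)`: functions that are `Cε`-Lipschitz and satisfy
`f(x+h) + f(x-h) - 2f(x) ≤ Cε²|h|²` for all `x, h`. -/
def memF {E : Type*} [NormedAddCommGroup E] (C ε : ℝ) (f : E → ℝ) : Prop :=
  LipschitzWith (C * ε).toNNReal f ∧
    ∀ x h : E, f (x + h) + f (x - h) - 2 * f x ≤ C * ε ^ 2 * ‖h‖ ^ 2

/-- The class `F_n(C,ε)` of functions on `(ℝ^d)^n`: functions belonging to `F(C,ε)`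
with respect to each `ℝ^d`-coordinate block separately. -/
def memFn {d n : ℕ} (C ε : ℝ) (f : (Fin n → EuclideanSpace ℝ (Fin d)) → ℝ) : Prop :=
  ∀ (i : Fin n) (x : Fin n → EuclideanSpace ℝ (Fin d)),
    memF C ε fun y => f (Function.update x i y)

/-- The quadratic infimum convolution on `(ℝ^d)^n ≅ ℝ^{nd}`:
`Hf(z) = inf_w ( f(z+w) + ½|w|² )` with the Euclidean norm `|w|² = ∑ |wᵢ|²`. -/
noncomputable def Hn {d n : ℕ} (f : (Fin n → EuclideanSpace ℝ (Fin d)) → ℝ)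
    (x : Fin n → EuclideanSpace ℝ (Fin d)) : ℝ :=
  ⨅ w : Fin n → EuclideanSpace ℝ (Fin d), (f (x + w) + (∑ i, ‖w i‖ ^ 2) / 2)

open scoped ENNReal

theorem volume_add_le_volume_of_isCompact {K L C : Set ℝ} (hK : IsCompact K) (hL : IsCompact L)
    (hK0 : K.Nonempty) (hL0 : L.Nonempty) (hC : ∀ a ∈ K, ∀ b ∈ L, a + b ∈ C) :
    volume K + volume L ≤ volume C := by
  have ha := hK.sSup_mem hK0
  have hb := hL.sInf_mem hL0
  set a := sSup K with ha'
  set b := sInf L with hb'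
  have h1 : volume ((fun x => b + x) '' K) = volume K := by
    simp only [Set.image_add_left, measure_preimage_add]
  have h2 : volume ((fun x => a + x) '' L) = volume L := by
    simp only [Set.image_add_left, measure_preimage_add]
  have hm : MeasurableSet ((fun x => a + x) '' L) :=
    (hL.image (by fun_prop)).measurableSet
  rw [← h1, ← h2, ← measure_union₀ hm.nullMeasurableSet]
  · refine measure_mono (Set.union_subset ?_ ?_)
    · rintro _ ⟨x, hx, rfl⟩
      simpa only [add_comm] using hC x hx b hb
    · rintro _ ⟨x, hx, rfl⟩
      exact hC a ha x hx
  · refine measure_mono_null (t := {a + b}) ?_ (by simp)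
    rintro _ ⟨⟨x, hx, rfl⟩, ⟨y, hy, hxy⟩⟩
    have h3 : x ≤ a := le_csSup hK.bddAbove hx
    have h4 : b ≤ y := csInf_le hL.bddBelow hy
    simp only [Set.mem_singleton_iff] at hxy ⊢
    linarith

theorem volume_add_le_volume {A B C : Set ℝ} (hA : MeasurableSet A) (hB : MeasurableSet B)
    (hA0 : A.Nonempty) (hB0 : B.Nonempty) (hC : ∀ a ∈ A, ∀ b ∈ B, a + b ∈ C) :
    volume A + volume B ≤ volume C := by
  obtain ⟨a₀, ha₀⟩ := hA0
  obtain ⟨b₀, hb₀⟩ := hB0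
  have key : ∀ K ⊆ A, IsCompact K → ∀ L ⊆ B, IsCompact L → volume K + volume L ≤ volume C := by
    intro K hKA hK L hLB hL
    calc volume K + volume L ≤ volume (insert a₀ K) + volume (insert b₀ L) := by
          gcongr <;> exact Set.subset_insert _ _
      _ ≤ volume C := volume_add_le_volume_of_isCompact (hK.insert _) (hL.insert _)
          (Set.insert_nonempty _ _) (Set.insert_nonempty _ _) fun a ha b hb =>
            hC a (Set.insert_subset ha₀ hKA ha) b (Set.insert_subset hb₀ hLB hb)
  have hsup : ∀ S : Set ℝ, MeasurableSet S →
      volume S = ⨆ K : {K : Set ℝ // K ⊆ S ∧ IsCompact K}, volume K.1 := by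
    intro S hS
    rw [hS.measure_eq_iSup_isCompact, iSup_subtype]
    simp_rw [iSup_and]
  have hne : ∀ S : Set ℝ, Nonempty {K : Set ℝ // K ⊆ S ∧ IsCompact K} := fun S =>
    ⟨⟨∅, Set.empty_subset S, isCompact_empty⟩⟩
  have := hne A
  have := hne B
  rw [hsup A hA, hsup B hB]
  exact ENNReal.iSup_add_iSup_le fun K L => key K.1 K.2.1 K.2.2 L.1 L.2.1 L.2.2

/-- One-dimensional Prékopa–Leindler inequality for functions of supremum one. -/
theorem lintegral_add_lintegral_le_of_iSup_eq_one {f g h : ℝ → ℝ} (hf : Measurable f)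
    (hg : Measurable g) (hh : Measurable h) (hf0 : ∀ x, 0 ≤ f x) (hg0 : ∀ x, 0 ≤ g x)
    (hh0 : ∀ x, 0 ≤ h x) (hf1 : ∀ x, f x ≤ 1) (hg1 : ∀ x, g x ≤ 1)
    (hfs : ∀ t < 1, ∃ x, t < f x) (hgs : ∀ t < 1, ∃ x, t < g x)
    (hfg : ∀ a b, f a * g b ≤ h ((a + b) / 2) ^ 2) :
    (∫⁻ x, ENNReal.ofReal (f x)) + (∫⁻ x, ENNReal.ofReal (g x)) ≤
      2 * ∫⁻ x, ENNReal.ofReal (h x) := by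
  rw [lintegral_eq_lintegral_meas_lt _ (.of_forall hf0) hf.aemeasurable,
    lintegral_eq_lintegral_meas_lt _ (.of_forall hg0) hg.aemeasurable,
    lintegral_eq_lintegral_meas_lt _ (.of_forall hh0) hh.aemeasurable,
    ← lintegral_add_left, ← lintegral_const_mul]
  · refine setLIntegral_mono' measurableSet_Ioi fun t (ht : 0 < t) => ?_
    by_cases ht1 : t < 1
    · have hC : volume ((fun x => x / 2) ⁻¹' {x | t < h x}) = 2 * volume {x | t < h x} := by
        have := Real.volume_preimage_mul_right (a := (2 : ℝ)⁻¹) (by norm_num) {x | t < h x}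
        simpa [div_eq_mul_inv] using this
      rw [← hC]
      refine volume_add_le_volume (measurableSet_lt measurable_const hf)
        (measurableSet_lt measurable_const hg) (hfs t ht1) (hgs t ht1) fun a ha b hb => ?_
      have ha : t < f a := ha
      have hb : t < g b := hb
      show t < h ((a + b) / 2)
      refine lt_of_pow_lt_pow_left₀ 2 (hh0 _) ((?_ : t ^ 2 < _).trans_le (hfg a b))
      nlinarith
    · have h1 : {x | t < f x} = ∅ := by
        ext x; simpa using (hf1 x).trans (not_lt.1 ht1)
      have h2 : {x | t < g x} = ∅ := by
        ext x; simpa using (hg1 x).trans (not_lt.1 ht1)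
      simp [h1, h2]
  · refine Antitone.measurable fun s t hst => measure_mono fun x (hx : t < h x) => hst.trans_lt hx
  · refine Antitone.measurable fun s t hst => measure_mono fun x (hx : t < f x) => hst.trans_lt hx

theorem ENNReal.mul_le_sq_of_add_le {a b c : ℝ≥0∞} (h : a + b ≤ 2 * c) : a * b ≤ c ^ 2 := by
  rcases eq_or_ne c ∞ with rfl | hc
  · simp
  have hab : a + b ≠ ∞ := (h.trans_lt (ENNReal.mul_lt_top (by simp) hc.lt_top)).ne
  obtain ⟨ha, hb⟩ := ENNReal.add_ne_top.1 hab
  lift a to NNReal using ha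
  lift b to NNReal using hb
  lift c to NNReal using hc
  norm_cast at h ⊢
  rw [← NNReal.coe_le_coe] at h ⊢
  push_cast at h ⊢
  nlinarith [sq_nonneg ((a : ℝ) - b), a.coe_nonneg, b.coe_nonneg, c.coe_nonneg]

/-- One-dimensional Prékopa–Leindler inequality for bounded functions. -/
theorem lintegral_mul_lintegral_le_sq {f g h : ℝ → ℝ} (hf : Measurable f)
    (hg : Measurable g) (hh : Measurable h) (hf0 : ∀ x, 0 ≤ f x) (hg0 : ∀ x, 0 ≤ g x)
    (hh0 : ∀ x, 0 ≤ h x) (hf1 : BddAbove (Set.range f)) (hg1 : BddAbove (Set.range g))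
    (hfg : ∀ a b, f a * g b ≤ h ((a + b) / 2) ^ 2) :
    (∫⁻ x, ENNReal.ofReal (f x)) * (∫⁻ x, ENNReal.ofReal (g x)) ≤
      (∫⁻ x, ENNReal.ofReal (h x)) ^ 2 := by
  by_cases hfz : ∀ x, f x = 0
  · simp [hfz]
  by_cases hgz : ∀ x, g x = 0
  · simp [hgz]
  push Not at hfz hgz
  obtain ⟨x₀, hx₀⟩ := hfz
  obtain ⟨y₀, hy₀⟩ := hgz
  set m := ⨆ x, f x with hm
  set k := ⨆ x, g x with hk
  have hfm : ∀ x, f x ≤ m := le_ciSup hf1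
  have hgk : ∀ x, g x ≤ k := le_ciSup hg1
  have hm0 : 0 < m := ((hf0 x₀).lt_of_ne' hx₀).trans_le (hfm x₀)
  have hk0 : 0 < k := ((hg0 y₀).lt_of_ne' hy₀).trans_le (hgk y₀)
  have scale : ∀ (c : ℝ) (u : ℝ → ℝ), 0 < c → Measurable u →
      ∫⁻ x, ENNReal.ofReal (u x) = ENNReal.ofReal c * ∫⁻ x, ENNReal.ofReal (u x / c) := by
    intro c u hc hu
    rw [← lintegral_const_mul _ (by fun_prop)]
    refine lintegral_congr fun x => ?_
    rw [← ENNReal.ofReal_mul hc.le, mul_div_cancel₀ _ hc.ne']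
  have hs0 : 0 < √(m * k) := Real.sqrt_pos.2 (mul_pos hm0 hk0)
  have key := lintegral_add_lintegral_le_of_iSup_eq_one (f := fun x => f x / m)
    (g := fun x => g x / k) (h := fun x => h x / √(m * k)) (by fun_prop) (by fun_prop)
    (by fun_prop) (fun x => div_nonneg (hf0 x) hm0.le) (fun x => div_nonneg (hg0 x) hk0.le)
    (fun x => div_nonneg (hh0 x) hs0.le) (fun x => (div_le_one hm0).2 (hfm x))
    (fun x => (div_le_one hk0).2 (hgk x))
    (fun t ht => by
      obtain ⟨x, hx⟩ := exists_lt_of_lt_ciSup (show t * m < ⨆ x, f x by nlinarith)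
      exact ⟨x, (lt_div_iff₀ hm0).2 hx⟩)
    (fun t ht => by
      obtain ⟨x, hx⟩ := exists_lt_of_lt_ciSup (show t * k < ⨆ x, g x by nlinarith)
      exact ⟨x, (lt_div_iff₀ hk0).2 hx⟩)
    (fun a b => by
      rw [div_pow, Real.sq_sqrt (mul_pos hm0 hk0).le, div_mul_div_comm]
      gcongr
      exact hfg a b)
  have key := ENNReal.mul_le_sq_of_add_le key
  rw [scale m f hm0 hf, scale k g hk0 hg, scale _ h hs0 hh, mul_pow, ← ENNReal.ofReal_pow hs0.le,
    Real.sq_sqrt (mul_pos hm0 hk0).le, mul_mul_mul_comm, ← ENNReal.ofReal_mul hm0.le]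
  gcongr

/-- Truncation in both the argument and the value. -/
noncomputable def cutoff {E : Type*} [Norm E] (N : ℕ) (f : E → ℝ≥0∞) (x : E) : ℝ≥0∞ :=
  if ‖x‖ ≤ N then min (f x) N else 0

section cutoff

variable {E : Type*} [NormedAddCommGroup E] {f : E → ℝ≥0∞}

theorem cutoff_le (N : ℕ) (f : E → ℝ≥0∞) (x : E) : cutoff N f x ≤ f x := by
  unfold cutoff; split_ifs <;> simp

theorem cutoff_le_natCast (N : ℕ) (f : E → ℝ≥0∞) (x : E) : cutoff N f x ≤ N := by
  unfold cutoff; split_ifs <;> simp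

theorem cutoff_ne_top (N : ℕ) (f : E → ℝ≥0∞) (x : E) : cutoff N f x ≠ ∞ :=
  ((cutoff_le_natCast N f x).trans_lt (ENNReal.natCast_lt_top N)).ne

theorem norm_le_of_cutoff_ne_zero {N : ℕ} {x : E} (h : cutoff N f x ≠ 0) : ‖x‖ ≤ N := by
  by_contra hx
  exact h (if_neg hx)

variable [MeasurableSpace E] [BorelSpace E]

theorem Measurable.cutoff (hf : Measurable f) (N : ℕ) : Measurable (cutoff N f) :=
  Measurable.ite (measurableSet_le measurable_norm measurable_const) (hf.min measurable_const)
    measurable_const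

theorem lintegral_eq_iSup_cutoff (hf : Measurable f) (μ : Measure E) :
    ∫⁻ x, f x ∂μ = ⨆ N : ℕ, ∫⁻ x, cutoff N f x ∂μ := by
  rw [← lintegral_iSup (fun N => hf.cutoff N)]
  · refine lintegral_congr fun x => le_antisymm ?_ (iSup_le fun N => cutoff_le N f x)
    refine le_of_forall_lt fun c hc => ?_
    obtain ⟨N, hN⟩ := ENNReal.exists_nat_gt hc.ne_top
    obtain ⟨M, hM⟩ := exists_nat_ge ‖x‖
    refine lt_of_lt_of_le ?_ (le_iSup _ (max N M))
    have hx : ‖x‖ ≤ (max N M : ℕ) := hM.trans (by exact_mod_cast le_max_right N M)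
    rw [_root_.cutoff, if_pos hx]
    exact lt_min hc (hN.trans_le (by exact_mod_cast le_max_left N M))
  · intro N M hNM x
    have hNM' : (N : ℝ) ≤ M := by exact_mod_cast hNM
    show _root_.cutoff N f x ≤ _root_.cutoff M f x
    unfold _root_.cutoff
    split_ifs with h1 h2
    · gcongr
    · exact absurd (h1.trans hNM') h2
    · simp
    · simp

end cutoff

theorem lintegral_Ioi_eq_lintegral_exp (u : ℝ → ℝ≥0∞) :
    ∫⁻ s in Set.Ioi 0, u s = ∫⁻ a, ENNReal.ofReal (exp a) * u (exp a) := by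
  have := lintegral_image_eq_lintegral_abs_deriv_mul MeasurableSet.univ
    (fun x _ => (Real.hasDerivAt_exp x).hasDerivWithinAt) Real.exp_injective.injOn u
  simpa [Set.image_univ, Real.range_exp, abs_of_pos (Real.exp_pos _)] using this

theorem lintegral_exp_gaussian_sq :
    (∫⁻ a, ENNReal.ofReal (exp a * exp (-(exp a ^ 2) / 2))) ^ 2 = ENNReal.ofReal (π / 2) := by
  have h : ∫⁻ a, ENNReal.ofReal (exp a * exp (-(exp a ^ 2) / 2)) =
      ∫⁻ s in Set.Ioi 0, ENNReal.ofReal (exp (-(1 / 2) * s ^ 2)) := by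
    rw [lintegral_Ioi_eq_lintegral_exp]
    refine lintegral_congr fun a => ?_
    rw [← ENNReal.ofReal_mul (exp_pos a).le]
    congr 3
    ring
  rw [h, ← ofReal_integral_eq_lintegral_ofReal, integral_gaussian_Ioi, ← ENNReal.ofReal_pow,
    div_pow, Real.sq_sqrt]
  · congr 1; ring
  · positivity
  · positivity
  · exact (integrable_exp_neg_mul_sq (by norm_num)).integrableOn
  · exact .of_forall fun x => (exp_pos _).le

/-- Functional Santaló inequality on the half-line. -/
theorem lintegral_Ioi_mul_lintegral_Ioi_le {f g : ℝ → ℝ≥0∞} (hf : Measurable f)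
    (hg : Measurable g)
    (hfg : ∀ s > 0, ∀ t > 0, f s * g t ≤ ENNReal.ofReal (exp (-(s * t)))) :
    (∫⁻ s in Set.Ioi 0, f s) * (∫⁻ t in Set.Ioi 0, g t) ≤ ENNReal.ofReal (π / 2) := by
  rw [lintegral_eq_iSup_cutoff hf, lintegral_eq_iSup_cutoff hg, ENNReal.iSup_mul]
  refine iSup_le fun N => ?_
  rw [ENNReal.mul_iSup]
  refine iSup_le fun M => ?_
  have toReal : ∀ (N : ℕ) (u : ℝ → ℝ≥0∞), ∫⁻ s in Set.Ioi 0, cutoff N u s =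
      ∫⁻ a, ENNReal.ofReal (exp a * (cutoff N u (exp a)).toReal) := by
    intro N u
    rw [lintegral_Ioi_eq_lintegral_exp]
    refine lintegral_congr fun a => ?_
    rw [ENNReal.ofReal_mul (exp_pos a).le, ENNReal.ofReal_toReal (cutoff_ne_top N u _)]
  have bdd : ∀ (N : ℕ) (u : ℝ → ℝ≥0∞),
      BddAbove (Set.range fun a => exp a * (cutoff N u (exp a)).toReal) := by
    rintro N u
    refine ⟨N * N, ?_⟩
    rintro _ ⟨a, rfl⟩
    by_cases h0 : cutoff N u (exp a) = 0
    · simp only [h0, ENNReal.toReal_zero, mul_zero]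
      positivity
    · have h1 := norm_le_of_cutoff_ne_zero h0
      rw [Real.norm_eq_abs, abs_of_pos (exp_pos a)] at h1
      have h2 := ENNReal.toReal_mono (ENNReal.natCast_ne_top N) (cutoff_le_natCast N u (exp a))
      rw [ENNReal.toReal_natCast] at h2
      exact mul_le_mul h1 h2 ENNReal.toReal_nonneg (by positivity)
  rw [toReal, toReal, ← lintegral_exp_gaussian_sq]
  refine lintegral_mul_lintegral_le_sq
    (measurable_exp.mul ((hf.cutoff N).comp measurable_exp).ennreal_toReal)
    (measurable_exp.mul ((hg.cutoff M).comp measurable_exp).ennreal_toReal)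
    (by fun_prop) (fun a => by positivity) (fun a => by positivity) (fun a => by positivity)
    (bdd N f) (bdd M g) fun a b => ?_
  have h1 : (cutoff N f (exp a)).toReal * (cutoff M g (exp b)).toReal ≤
      exp (-(exp a * exp b)) := by
    rw [← ENNReal.toReal_mul]
    refine ENNReal.toReal_le_of_le_ofReal (exp_pos _).le ?_
    exact (mul_le_mul' (cutoff_le N f _) (cutoff_le M g _)).trans
      (hfg _ (exp_pos a) _ (exp_pos b))
  have h2 : (exp ((a + b) / 2) * exp (-(exp ((a + b) / 2) ^ 2) / 2)) ^ 2 =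
      exp a * exp b * exp (-(exp a * exp b)) := by
    rw [mul_pow, ← Real.exp_nat_mul, ← Real.exp_nat_mul, ← Real.exp_add a b]
    congr 2
    · push_cast; ring
    · push_cast; ring_nf
  rw [h2, mul_mul_mul_comm]
  gcongr

/-- Nonnegative bounded measurable functions with bounded support. -/
structure IsTame {E : Type*} [NormedAddCommGroup E] [MeasurableSpace E] (f : E → ℝ) : Prop where
  measurable : Measurable f
  nonneg : ∀ x, 0 ≤ f x
  bounded : ∃ M, ∀ x, f x ≤ M
  support : ∃ R, ∀ x, f x ≠ 0 → ‖x‖ ≤ R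

theorem isTame_toReal_cutoff {E : Type*} [NormedAddCommGroup E] [MeasurableSpace E]
    [BorelSpace E] {g : E → ℝ≥0∞} (hg : Measurable g) (N : ℕ) :
    IsTame fun x => (cutoff N g x).toReal where
  measurable := (hg.cutoff N).ennreal_toReal
  nonneg _ := ENNReal.toReal_nonneg
  bounded := ⟨N, fun x => by
    simpa using ENNReal.toReal_mono (ENNReal.natCast_ne_top N) (cutoff_le_natCast N g x)⟩
  support := ⟨N, fun x hx => norm_le_of_cutoff_ne_zero fun h =>
    hx (by rw [h, ENNReal.toReal_zero])⟩

theorem IsTame.comp_swap {X E : Type*} [NormedAddCommGroup X] [MeasurableSpace X]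
    [NormedAddCommGroup E] [MeasurableSpace E]
    {f : X × E → ℝ} (hf : IsTame f) : IsTame fun p : E × X => f p.swap where
  measurable := hf.measurable.comp measurable_swap
  nonneg _ := hf.nonneg _
  bounded := hf.bounded.imp fun _ h _ => h _
  support := hf.support.imp fun R h p hp => by
    have := h _ hp
    rwa [Prod.norm_def, Prod.fst_swap, Prod.snd_swap, max_comm] at this

/-- Partial integrals of tame functions are tame. -/
theorem IsTame.integral_left {X E : Type*} [NormedAddCommGroup E] [MeasurableSpace E]
    [NormedAddCommGroup X] [NormedSpace ℝ X] [FiniteDimensional ℝ X] [MeasurableSpace X]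
    [BorelSpace X] {f : X × E → ℝ} (hf : IsTame f)
    (ν : Measure X) [IsFiniteMeasureOnCompacts ν] [SFinite ν] :
    IsTame fun y => ∫ x, f (x, y) ∂ν where
  measurable := by
    have : StronglyMeasurable (fun p : E × X => f (p.2, p.1)) :=
      (hf.measurable.comp measurable_swap).stronglyMeasurable
    exact this.integral_prod_right.measurable
  nonneg y := integral_nonneg fun x => hf.nonneg _
  bounded := by
    have := FiniteDimensional.proper_real X
    obtain ⟨M, hM⟩ := hf.bounded
    obtain ⟨R, hR⟩ := hf.support
    refine ⟨∫ x in Metric.closedBall (0 : X) R, M ∂ν, fun y => ?_⟩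
    have hsupp : Function.support (fun x => f (x, y)) ⊆ Metric.closedBall 0 R := fun x hx => by
      rw [mem_closedBall_zero_iff]
      exact (norm_fst_le (x, y)).trans (hR _ hx)
    rw [← setIntegral_eq_integral_of_forall_compl_eq_zero (s := Metric.closedBall (0 : X) R)
      fun x hx => by_contra fun h => hx (hsupp h)]
    refine integral_mono_of_nonneg (.of_forall fun x => hf.nonneg _) ?_ (.of_forall fun x => hM _)
    exact integrableOn_const (isCompact_closedBall 0 R).measure_lt_top.ne
  support := by
    obtain ⟨R, hR⟩ := hf.support
    refine ⟨R, fun y hy => ?_⟩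
    by_contra h
    refine hy (integral_eq_zero_of_ae (.of_forall fun x => ?_))
    by_contra h0
    exact h ((norm_snd_le (x, y)).trans (hR _ h0))

section IsTame

variable {E F : Type*} [NormedAddCommGroup E] [NormedSpace ℝ E] [FiniteDimensional ℝ E]
  [MeasurableSpace E] [BorelSpace E] [NormedAddCommGroup F] [NormedSpace ℝ F]

theorem IsTame.integrable_smul {f : E → ℝ} (hf : IsTame f) (μ : Measure E)
    [IsFiniteMeasureOnCompacts μ] {φ : E → F} (hφ : Continuous φ) :
    Integrable (fun x => f x • φ x) μ := by
  have := FiniteDimensional.proper_real E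
  obtain ⟨M, hM⟩ := hf.bounded
  obtain ⟨R, hR⟩ := hf.support
  have h1 : IntegrableOn φ (Metric.closedBall 0 R) μ :=
    hφ.continuousOn.integrableOn_compact (isCompact_closedBall 0 R)
  have h2 : IntegrableOn (fun x => f x • φ x) (Metric.closedBall 0 R) μ :=
    h1.bdd_smul M hf.measurable.aestronglyMeasurable
      (.of_forall fun x => by rw [Real.norm_eq_abs, abs_of_nonneg (hf.nonneg x)]; exact hM x)
  refine (integrableOn_iff_integrable_of_support_subset fun x hx => ?_).1 h2
  rw [mem_closedBall_zero_iff]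
  exact hR x fun h => hx (by simp [h])

theorem IsTame.integrable {f : E → ℝ} (hf : IsTame f) (μ : Measure E)
    [IsFiniteMeasureOnCompacts μ] : Integrable f μ := by
  simpa using hf.integrable_smul μ (continuous_const (y := (1 : ℝ)))

theorem IsTame.integrable_mul {f : E → ℝ} (hf : IsTame f) (μ : Measure E)
    [IsFiniteMeasureOnCompacts μ] {φ : E → ℝ} (hφ : Continuous φ) :
    Integrable (fun x => f x * φ x) μ :=
  hf.integrable_smul μ hφ

/-- A point splitting the mass of a tame density on the line into two equal parts. -/
theorem IsTame.exists_integral_Ioi_eq_integral_Iio {G : ℝ → ℝ} (hG : IsTame G) :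
    ∃ t, ∫ s in Set.Ioi t, G s = (∫ s, G s) / 2 ∧ ∫ s in Set.Iio t, G s = (∫ s, G s) / 2 := by
  have hint := hG.integrable volume
  obtain ⟨R, hR⟩ := hG.support
  have hm : 0 ≤ ∫ s, G s := integral_nonneg hG.nonneg
  have hJ : Continuous fun t => ∫ s in Set.Iic t, G s := by
    have h : (fun t => ∫ s in Set.Iic t, G s) =
        fun t => (∫ s in (0 : ℝ)..t, G s) + ∫ s in Set.Iic 0, G s := by
      ext t
      rw [← intervalIntegral.integral_Iic_sub_Iic hint.integrableOn hint.integrableOn]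
      ring
    rw [h]
    exact (intervalIntegral.continuous_primitive (fun a b => hint.intervalIntegrable) 0).add
      continuous_const
  have h1 : ∫ s in Set.Iic (-R - 1), G s = 0 := by
    refine setIntegral_eq_zero_of_forall_eq_zero fun s hs => ?_
    by_contra h
    have := abs_le.1 (hR s h)
    have hs : s ≤ -R - 1 := hs
    linarith
  have h2 : ∫ s in Set.Iic R, G s = ∫ s, G s := by
    refine setIntegral_eq_integral_of_forall_compl_eq_zero fun s hs => ?_
    by_contra h
    exact hs (abs_le.1 (hR s h)).2
  obtain ⟨t, ht⟩ := mem_range_of_exists_le_of_exists_ge hJ (c := (∫ s, G s) / 2)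
    ⟨-R - 1, by rw [h1]; linarith⟩ ⟨R, by rw [h2]; linarith⟩
  have h3 := integral_add_compl (measurableSet_Iic (a := t)) hint
  rw [Set.compl_Iic] at h3
  refine ⟨t, ?_, ?_⟩
  · simp only at ht
    linarith
  · rw [← ht]
    exact setIntegral_congr_set Iio_ae_eq_Iic

end IsTame

/-- The functional Santaló inequality, with constant `c`, for the pairing `B` and measure `μ`,
for pairs whose first function is tame and has barycenter zero. -/
def SantaloBound {E : Type*} [NormedAddCommGroup E] [NormedSpace ℝ E] [MeasurableSpace E]
    (μ : Measure E) (B : E → E → ℝ) (c : ℝ≥0∞) : Prop :=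
  ∀ (f : E → ℝ) (g : E → ℝ≥0∞), IsTame f → Measurable g → ∫ x, f x • x ∂μ = 0 →
    (∀ x y, ENNReal.ofReal (f x) * g y ≤ ENNReal.ofReal (exp (-B x y))) →
    (∫⁻ x, ENNReal.ofReal (f x) ∂μ) * ∫⁻ y, g y ∂μ ≤ c

theorem lintegral_Iio_mul_lintegral_Iio_le {f g : ℝ → ℝ≥0∞} (hf : Measurable f)
    (hg : Measurable g)
    (hfg : ∀ s < 0, ∀ t < 0, f s * g t ≤ ENNReal.ofReal (exp (-(s * t)))) :
    (∫⁻ s in Set.Iio 0, f s) * (∫⁻ t in Set.Iio 0, g t) ≤ ENNReal.ofReal (π / 2) := by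
  have h : ∀ u : ℝ → ℝ≥0∞, Measurable u →
      ∫⁻ s in Set.Iio 0, u s = ∫⁻ s in Set.Ioi 0, u (-s) := by
    intro u hu
    have := ((Measure.measurePreserving_neg (volume : Measure ℝ)).restrict_preimage
      (measurableSet_Iio (a := (0 : ℝ)))).lintegral_comp hu
    simpa using this.symm
  rw [h f hf, h g hg]
  refine lintegral_Ioi_mul_lintegral_Ioi_le (hf.comp measurable_neg) (hg.comp measurable_neg)
    fun s hs t ht => ?_
  simpa using hfg (-s) (neg_lt_zero.2 hs) (-t) (neg_lt_zero.2 ht)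

section step

variable {E : Type*} [NormedAddCommGroup E] [NormedSpace ℝ E] [FiniteDimensional ℝ E]
  [MeasurableSpace E] [BorelSpace E] {μ : Measure E} [μ.IsAddHaarMeasure]
  {B : E →L[ℝ] E →L[ℝ] ℝ} {c : ℝ≥0∞}

theorem SantaloBound.half_prod (hQ : SantaloBound μ (fun x y => B x y) c)
    (hB : ∀ x y, B x y = B y x) {S : Set ℝ}
    (hS1 : ∀ f g : ℝ → ℝ≥0∞, Measurable f → Measurable g →
      (∀ s ∈ S, ∀ t ∈ S, f s * g t ≤ ENNReal.ofReal (exp (-(s * t)))) →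
      (∫⁻ s in S, f s) * (∫⁻ t in S, g t) ≤ ENNReal.ofReal (π / 2))
    {g : ℝ × E → ℝ} (hg : IsTame g) {f : ℝ × E → ℝ≥0∞} (hf : Measurable f)
    (hg0 : ∫ q, g q • q.2 ∂((volume.restrict S).prod μ) = 0)
    (hfg : ∀ p q, f p * ENNReal.ofReal (g q) ≤ ENNReal.ofReal (exp (-(p.1 * q.1 + B p.2 q.2)))) :
    (∫⁻ q, ENNReal.ofReal (g q) ∂((volume.restrict S).prod μ)) *
      (∫⁻ p, f p ∂((volume.restrict S).prod μ)) ≤ ENNReal.ofReal (π / 2) * c := by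
  have hπ : ENNReal.ofReal (π / 2) ≠ 0 := by
    rw [Ne, ENNReal.ofReal_eq_zero, not_le]; positivity
  have hG : ∀ y, ENNReal.ofReal (∫ r in S, g (r, y)) = ∫⁻ r in S, ENNReal.ofReal (g (r, y)) := by
    intro y
    refine ofReal_integral_eq_lintegral_ofReal ?_ (.of_forall fun r => hg.nonneg _)
    have hgy : IsTame fun r => g (r, y) :=
      { measurable := hg.measurable.comp measurable_prodMk_right
        nonneg := fun r => hg.nonneg _
        bounded := hg.bounded.imp fun _ h r => h _
        support := hg.support.imp fun _ h r hr => (norm_fst_le (r, y)).trans (h _ hr) }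
    exact hgy.integrable _
  have key := hQ (fun y => ∫ r in S, g (r, y))
    (fun x => (ENNReal.ofReal (π / 2))⁻¹ * ∫⁻ a in S, f (a, x))
    (hg.integral_left _) (hf.lintegral_prod_left'.const_mul _) ?_ ?_
  · simp_rw [hG] at key
    rw [lintegral_const_mul _ hf.lintegral_prod_left', mul_left_comm,
      ENNReal.inv_mul_le_iff hπ ENNReal.ofReal_ne_top] at key
    rwa [lintegral_prod_symm' _ hf, lintegral_prod_symm' _ hg.measurable.ennreal_ofReal]
  · rw [integral_prod_symm _ (hg.integrable_smul _ continuous_snd)] at hg0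
    simpa only [integral_smul_const] using hg0
  · intro y x
    rw [hG, mul_left_comm, ENNReal.inv_mul_le_iff hπ ENNReal.ofReal_ne_top]
    have h1 := hS1 (fun r => ENNReal.ofReal (g (r, y)))
      (fun a => ENNReal.ofReal (exp (B y x)) * f (a, x))
      (hg.measurable.comp measurable_prodMk_right).ennreal_ofReal
      ((hf.comp measurable_prodMk_right).const_mul _) fun s _ t _ => by
        calc ENNReal.ofReal (g (s, y)) * (ENNReal.ofReal (exp (B y x)) * f (t, x))
            = ENNReal.ofReal (exp (B y x)) * (f (t, x) * ENNReal.ofReal (g (s, y))) := by ring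
          _ ≤ ENNReal.ofReal (exp (B y x)) * ENNReal.ofReal (exp (-(t * s + B x y))) := by
              gcongr; exact hfg _ _
          _ = ENNReal.ofReal (exp (-(s * t))) := by
              rw [← ENNReal.ofReal_mul (exp_pos _).le, ← Real.exp_add, hB y x]
              congr 2; ring
    rw [lintegral_const_mul _ (show Measurable fun a => f (a, x) from
      hf.comp measurable_prodMk_right)] at h1
    calc (∫⁻ r in S, ENNReal.ofReal (g (r, y))) * ∫⁻ a in S, f (a, x)
        = ENNReal.ofReal (exp (-B y x)) * ((∫⁻ r in S, ENNReal.ofReal (g (r, y))) *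
            (ENNReal.ofReal (exp (B y x)) * ∫⁻ a in S, f (a, x))) := by
          have : ENNReal.ofReal (exp (-B y x)) * ENNReal.ofReal (exp (B y x)) = 1 := by
            rw [← ENNReal.ofReal_mul (exp_pos _).le, ← Real.exp_add]; simp
          rw [mul_left_comm (∫⁻ r in S, ENNReal.ofReal (g (r, y))), ← mul_assoc, this, one_mul]
      _ ≤ ENNReal.ofReal (exp (-B y x)) * ENNReal.ofReal (π / 2) := by gcongr
      _ = _ := mul_comm _ _

end step

/-- Change of variables along a measure preserving map that need not be an embedding. -/
theorem MeasureTheory.MeasurePreserving.integral_comp_of_aestronglyMeasurable {α β F : Type*}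
    [MeasurableSpace α] [MeasurableSpace β] [NormedAddCommGroup F] [NormedSpace ℝ F]
    {μ : Measure α} {ν : Measure β} {T : α → β} (h : MeasurePreserving T μ ν) {φ : β → F}
    (hφ : AEStronglyMeasurable φ ν) : ∫ x, φ (T x) ∂μ = ∫ y, φ y ∂ν := by
  rw [← h.map_eq] at hφ ⊢
  exact (integral_map h.measurable.aemeasurable hφ).symm

section step

variable {E : Type*} [NormedAddCommGroup E] [NormedSpace ℝ E] [FiniteDimensional ℝ E]
  [MeasurableSpace E] [BorelSpace E] {μ : Measure E} [μ.IsAddHaarMeasure]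
  {B : E →L[ℝ] E →L[ℝ] ℝ} {c : ℝ≥0∞}

/-- The affine shear `(r, y) ↦ (t + r, w + r • u + y)`. -/
def affineShear (t : ℝ) (w u : E) (p : ℝ × E) : ℝ × E := (t + p.1, w + p.1 • u + p.2)

theorem measurePreserving_affineShear (t : ℝ) (w u : E) :
    MeasurePreserving (affineShear t w u) (volume.prod μ) (volume.prod μ) := by
  refine (measurePreserving_add_left volume t).skew_product (g := fun r y => w + r • u + y)
    (by fun_prop) (.of_forall fun r => ?_)
  exact (measurePreserving_add_left μ (w + r • u)).map_eq

theorem IsTame.comp_affineShear {g : ℝ × E → ℝ} (hg : IsTame g) (t : ℝ) (w u : E) :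
    IsTame fun p => g (affineShear t w u p) where
  measurable := hg.measurable.comp (by unfold affineShear; fun_prop)
  nonneg _ := hg.nonneg _
  bounded := hg.bounded.imp fun _ h _ => h _
  support := by
    obtain ⟨R, hR⟩ := hg.support
    refine ⟨max (R + ‖t‖) (R + ‖w‖ + (R + ‖t‖) * ‖u‖), fun p hp => ?_⟩
    have h := hR _ hp
    have h1 : ‖t + p.1‖ ≤ R := (norm_fst_le (affineShear t w u p)).trans h
    have h2 : ‖w + p.1 • u + p.2‖ ≤ R := (norm_snd_le (affineShear t w u p)).trans h
    have h3 : ‖p.1‖ ≤ R + ‖t‖ := by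
      calc ‖p.1‖ = ‖(t + p.1) - t‖ := by congr 1; ring
        _ ≤ ‖t + p.1‖ + ‖t‖ := norm_sub_le _ _
        _ ≤ R + ‖t‖ := by gcongr
    refine max_le_max h3 ?_
    calc ‖p.2‖ = ‖(w + p.1 • u + p.2) - w - p.1 • u‖ := by congr 1; abel
      _ ≤ ‖w + p.1 • u + p.2‖ + ‖w‖ + ‖p.1 • u‖ :=
          (norm_sub_le _ _).trans (add_le_add_left (norm_sub_le _ _) _)
      _ ≤ R + ‖w‖ + (R + ‖t‖) * ‖u‖ := by rw [norm_smul]; gcongr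

/-- Existence of a mass-halving point and a shear centering both halves of a tame density. -/
theorem IsTame.exists_affineShear {g : ℝ × E → ℝ} (hg : IsTame g)
    (hpos : 0 < ∫ q, g q ∂(volume.prod μ)) : ∃ (t : ℝ) (w u : E),
      ∀ S ∈ ({Set.Ioi 0, Set.Iio 0} : Set (Set ℝ)),
        ∫ q, g (affineShear t w u q) ∂((volume.restrict S).prod μ) =
          (∫ q, g q ∂(volume.prod μ)) / 2 ∧
        ∫ q, g (affineShear t w u q) • q.2 ∂((volume.restrict S).prod μ) = 0 := by
  obtain ⟨t, hIoi, hIio⟩ := (hg.comp_swap.integral_left μ).exists_integral_Ioi_eq_integral_Iio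
  simp only [Prod.swap_prod_mk] at hIoi hIio
  have hm : ∫ s, ∫ y, g (s, y) ∂μ = ∫ q, g q ∂(volume.prod μ) :=
    (integral_prod _ (hg.integrable _)).symm
  rw [hm] at hIoi hIio
  set m := ∫ q, g q ∂(volume.prod μ)
  have hA : ∀ S : Set ℝ, ∫ q, g q ∂((volume.restrict S).prod μ) = ∫ s in S, ∫ y, g (s, y) ∂μ :=
    fun S => integral_prod _ (hg.integrable _)
  set X : Set ℝ → ℝ := fun S => ∫ q, g q * (q.1 - t) ∂((volume.restrict S).prod μ) with hX
  set Y : Set ℝ → E := fun S => ∫ q, g q • q.2 ∂((volume.restrict S).prod μ) with hY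
  have hXpos : X (Set.Ioi t) - X (Set.Iio t) ≠ 0 := by
    have hae : ∀ S : Set ℝ, MeasurableSet S → ∀ᵐ q ∂((volume.restrict S).prod μ), q.1 ∈ S := by
      intro S hS
      have h := ae_restrict_mem (μ := volume.prod μ) (hS.prod (MeasurableSet.univ (α := E)))
      rw [← Measure.prod_restrict, Measure.restrict_univ] at h
      exact h.mono fun q hq => hq.1
    have h1 : X (Set.Iio t) ≤ 0 :=
      integral_nonpos_of_ae ((hae _ measurableSet_Iio).mono fun q hq =>
        mul_nonpos_of_nonneg_of_nonpos (hg.nonneg q) (sub_nonpos.2 (le_of_lt hq)))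
    have h2 : 0 ≤ᵐ[(volume.restrict (Set.Ioi t)).prod μ] fun q => g q * (q.1 - t) :=
      (hae _ measurableSet_Ioi).mono fun q hq =>
        mul_nonneg (hg.nonneg q) (sub_nonneg.2 (le_of_lt hq))
    have h3 : X (Set.Ioi t) ≠ 0 := by
      intro h0
      have h4 := (integral_eq_zero_iff_of_nonneg_ae h2
        (hg.integrable_mul _ (by fun_prop : Continuous fun q : ℝ × E => q.1 - t))).1 h0
      have h5 : ∫ q, g q ∂((volume.restrict (Set.Ioi t)).prod μ) = 0 := by
        refine integral_eq_zero_of_ae ?_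
        filter_upwards [h4, hae _ measurableSet_Ioi] with q hq hqt
        exact (mul_eq_zero.1 hq).resolve_right (sub_pos.2 hqt).ne'
      rw [hA, hIoi] at h5
      linarith
    have h6 : 0 < X (Set.Ioi t) := (integral_nonneg_of_ae h2).lt_of_ne' h3
    linarith
  set u : E := (X (Set.Ioi t) - X (Set.Iio t))⁻¹ • (Y (Set.Ioi t) - Y (Set.Iio t)) with hu
  set w : E := (m / 2)⁻¹ • (Y (Set.Ioi t) - X (Set.Ioi t) • u) with hw
  have hplus : Y (Set.Ioi t) - (m / 2) • w - X (Set.Ioi t) • u = 0 := by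
    rw [hw, smul_inv_smul₀ (by positivity)]; abel
  have hminus : Y (Set.Iio t) - (m / 2) • w - X (Set.Iio t) • u = 0 := by
    have : (X (Set.Ioi t) - X (Set.Iio t)) • u = Y (Set.Ioi t) - Y (Set.Iio t) := by
      rw [hu, smul_inv_smul₀ hXpos]
    rw [sub_smul] at this
    calc Y (Set.Iio t) - (m / 2) • w - X (Set.Iio t) • u
        = (Y (Set.Ioi t) - (m / 2) • w - X (Set.Ioi t) • u) +
          (X (Set.Ioi t) • u - X (Set.Iio t) • u) - (Y (Set.Ioi t) - Y (Set.Iio t)) := by abel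
      _ = 0 := by rw [hplus, this]; abel
  have hmp : ∀ S' S : Set ℝ, MeasurableSet S → (fun r => t + r) ⁻¹' S = S' →
      MeasurePreserving (affineShear t w u) ((volume.restrict S').prod μ)
        ((volume.restrict S).prod μ) := by
    rintro _ S hS rfl
    have h := (measurePreserving_affineShear (μ := μ) t w u).restrict_preimage
      (hS.prod MeasurableSet.univ)
    have h1 : affineShear t w u ⁻¹' (S ×ˢ Set.univ) =
        ((fun r => t + r) ⁻¹' S) ×ˢ Set.univ := by
      ext; simp [affineShear]
    rw [h1, ← Measure.prod_restrict, ← Measure.prod_restrict, Measure.restrict_univ] at h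
    exact h
  have main : ∀ S' S : Set ℝ, MeasurableSet S → (fun r => t + r) ⁻¹' S = S' →
      ∫ s in S, ∫ y, g (s, y) ∂μ = m / 2 → Y S - (m / 2) • w - X S • u = 0 →
      ∫ q, g (affineShear t w u q) ∂((volume.restrict S').prod μ) = m / 2 ∧
        ∫ q, g (affineShear t w u q) • q.2 ∂((volume.restrict S').prod μ) = 0 := by
    intro S' S hS hSS' hmass hbar
    have h := hmp S' S hS hSS'
    refine ⟨?_, ?_⟩
    · rw [h.integral_comp_of_aestronglyMeasurable hg.measurable.aestronglyMeasurable, hA, hmass]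
    · have h1 := h.integral_comp_of_aestronglyMeasurable
        (hg.integrable_smul _ (by fun_prop :
          Continuous fun q : ℝ × E => q.2 - w - (q.1 - t) • u)).aestronglyMeasurable
      have h2 : ∀ q : ℝ × E, (affineShear t w u q).2 - w - ((affineShear t w u q).1 - t) • u
          = q.2 := by
        intro q
        simp only [affineShear, add_sub_cancel_left]
        abel
      simp only [h2] at h1
      rw [h1, ← hbar]
      have i1 := hg.integrable_smul ((volume.restrict S).prod μ)
        (continuous_snd : Continuous fun q : ℝ × E => q.2)
      have i2 := hg.integrable_smul ((volume.restrict S).prod μ)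
        (continuous_const : Continuous fun q : ℝ × E => w)
      have i3 := hg.integrable_smul ((volume.restrict S).prod μ)
        (by fun_prop : Continuous fun q : ℝ × E => (q.1 - t) • u)
      simp only [smul_sub]
      have i12 : Integrable (fun q : ℝ × E => g q • q.2 - g q • w)
          ((volume.restrict S).prod μ) := i1.sub i2
      rw [integral_sub i12 i3, integral_sub i1 i2, integral_smul_const, hA, hmass]
      simp only [smul_smul, integral_smul_const, hX, hY]
  refine ⟨t, w, u, ?_⟩
  rintro S (rfl | rfl)
  · exact main _ (Set.Ioi t) measurableSet_Ioi (by ext; simp) hIoi hplus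
  · exact main _ (Set.Iio t) measurableSet_Iio (by ext; simp) hIio hminus

/-- A tame density on `ℝ × E` can be translated so that the Santaló inequality holds. -/
theorem SantaloBound.exists_center (hQ : SantaloBound μ (fun x y => B x y) c)
    (hB : ∀ x y, B x y = B y x) {g : ℝ × E → ℝ} (hg : IsTame g)
    (hpos : 0 < ∫ q, g q ∂(volume.prod μ)) :
    ∃ z : ℝ × E, ∀ f : ℝ × E → ℝ≥0∞, Measurable f →
      (∀ p q, f p * ENNReal.ofReal (g (z + q)) ≤
        ENNReal.ofReal (exp (-(p.1 * q.1 + B p.2 q.2)))) →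
      (∫⁻ p, f p ∂(volume.prod μ)) * (∫⁻ q, ENNReal.ofReal (g q) ∂(volume.prod μ)) ≤
        ENNReal.ofReal (2 * π) * c := by
  obtain ⟨t, w, u, hS⟩ := hg.exists_affineShear hpos
  refine ⟨(t, w), fun f hf hfg => ?_⟩
  have hgT := hg.comp_affineShear t w u
  set m := ∫ q, g q ∂(volume.prod μ)
  set f' : ℝ × E → ℝ≥0∞ := fun p => f (p.1 - B u p.2, p.2) with hf'
  have hf'm : Measurable f' := hf.comp (by fun_prop)
  have hf'g : ∀ p q, f' p * ENNReal.ofReal (g (affineShear t w u q)) ≤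
      ENNReal.ofReal (exp (-(p.1 * q.1 + B p.2 q.2))) := by
    intro p q
    have h := hfg (p.1 - B u p.2, p.2) (q.1, q.1 • u + q.2)
    have h1 : affineShear t w u q = (t, w) + (q.1, q.1 • u + q.2) := by
      simp [affineShear, add_assoc]
    rw [h1]
    refine h.trans_eq ?_
    simp only [map_add, map_smul, smul_eq_mul, hB p.2 u]
    congr 3
    ring
  have hf'int : ∫⁻ p, f' p ∂(volume.prod μ) = ∫⁻ p, f p ∂(volume.prod μ) := by
    rw [lintegral_prod_symm' _ hf'm, lintegral_prod_symm' _ hf]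
    exact lintegral_congr fun x => lintegral_sub_right_eq_self (fun a => f (a, x)) (B u x)
  have hmass : ∫⁻ q, ENNReal.ofReal (g q) ∂(volume.prod μ) = 2 * ENNReal.ofReal (m / 2) := by
    rw [← ofReal_integral_eq_lintegral_ofReal (hg.integrable _) (.of_forall hg.nonneg),
      show (2 : ℝ≥0∞) = ENNReal.ofReal 2 by simp, ← ENNReal.ofReal_mul (by norm_num)]
    congr 1
    ring
  have hhalf : ∀ S ∈ ({Set.Ioi 0, Set.Iio 0} : Set (Set ℝ)),
      ENNReal.ofReal (m / 2) * ∫⁻ p, f' p ∂((volume.restrict S).prod μ) ≤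
        ENNReal.ofReal (π / 2) * c := by
    intro S hSmem
    obtain ⟨h1, h2⟩ := hS S hSmem
    rw [← h1, ofReal_integral_eq_lintegral_ofReal (hgT.integrable _) (.of_forall hgT.nonneg)]
    refine hQ.half_prod hB ?_ hgT hf'm h2 hf'g
    rcases hSmem with rfl | rfl
    · exact fun f g hf hg h => lintegral_Ioi_mul_lintegral_Ioi_le hf hg h
    · exact fun f g hf hg h => lintegral_Iio_mul_lintegral_Iio_le hf hg h
  have hsplit : (volume : Measure ℝ) =
      volume.restrict (Set.Ioi 0) + volume.restrict (Set.Iio 0) := by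
    conv_lhs => rw [← Measure.restrict_add_restrict_compl (μ := volume)
      (measurableSet_Ioi (a := (0 : ℝ))), Set.compl_Ioi]
    rw [Measure.restrict_congr_set Iio_ae_eq_Iic]
  have hsum : ENNReal.ofReal (m / 2) * ∫⁻ p, f' p ∂(volume.prod μ) ≤ ENNReal.ofReal π * c := by
    rw [hsplit, Measure.add_prod, lintegral_add_measure, mul_add]
    refine (add_le_add (hhalf _ (by simp)) (hhalf _ (by simp))).trans_eq ?_
    rw [← add_mul, ← ENNReal.ofReal_add (by positivity) (by positivity), add_halves]
  calc (∫⁻ p, f p ∂(volume.prod μ)) * (∫⁻ q, ENNReal.ofReal (g q) ∂(volume.prod μ))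
      = 2 * (ENNReal.ofReal (m / 2) * ∫⁻ p, f' p ∂(volume.prod μ)) := by
        rw [hmass, hf'int]; ring
    _ ≤ 2 * (ENNReal.ofReal π * c) := by gcongr
    _ = ENNReal.ofReal (2 * π) * c := by
        rw [ENNReal.ofReal_mul (by norm_num), ENNReal.ofReal_ofNat, mul_assoc]

/-- The Santaló inequality passes from `E` to `ℝ × E`. -/
theorem SantaloBound.real_prod (hQ : SantaloBound μ (fun x y => B x y) c)
    (hB : ∀ x y, B x y = B y x) :
    SantaloBound (volume.prod μ) (fun p q : ℝ × E => p.1 * q.1 + B p.2 q.2)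
      (ENNReal.ofReal (2 * π) * c) := by
  intro f g hf hg hf0 hfg
  rw [lintegral_eq_iSup_cutoff hg, ENNReal.mul_iSup]
  refine iSup_le fun N => ?_
  have hgN := isTame_toReal_cutoff hg N
  have hcut : ∀ q, ENNReal.ofReal (cutoff N g q).toReal = cutoff N g q := fun q =>
    ENNReal.ofReal_toReal (cutoff_ne_top N g q)
  have hnonneg : 0 ≤ ∫ q, (cutoff N g q).toReal ∂(volume.prod μ) := integral_nonneg hgN.nonneg
  rcases hnonneg.eq_or_lt with h0 | hpos
  · have : ∫⁻ q, cutoff N g q ∂(volume.prod μ) = 0 := by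
      rw [← lintegral_congr hcut, ← ofReal_integral_eq_lintegral_ofReal (hgN.integrable _)
        (.of_forall hgN.nonneg), ← h0, ENNReal.ofReal_zero]
    rw [this, mul_zero]
    exact zero_le
  obtain ⟨z, hz⟩ := hQ.exists_center hB hgN hpos
  set L : ℝ × E → ℝ := fun p => p.1 * z.1 + B p.2 z.2 with hL
  have hLc : Continuous L := by fun_prop
  have hi := hf.integrable (volume.prod μ)
  have hiL := hf.integrable_mul (volume.prod μ) hLc
  have hie := hf.integrable_mul (volume.prod μ)
    (show Continuous fun p => exp (L p) from Real.continuous_exp.comp hLc)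
  have hL0 : ∫ p, f p * L p ∂(volume.prod μ) = 0 := by
    let ℓ : ℝ × E →L[ℝ] ℝ := z.1 • ContinuousLinearMap.fst ℝ ℝ E +
      (B z.2).comp (ContinuousLinearMap.snd ℝ ℝ E)
    have hℓ : ∀ p, ℓ p = L p := fun p => by
      simp [ℓ, hL, hB z.2, mul_comm]
    have h := ℓ.integral_comp_comm (hf.integrable_smul (volume.prod μ) continuous_id)
    simp only [id, hf0, map_zero, map_smul, smul_eq_mul] at h
    simpa only [hℓ] using h
  have hmono : ∫⁻ p, ENNReal.ofReal (f p) ∂(volume.prod μ) ≤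
      ∫⁻ p, ENNReal.ofReal (f p * exp (L p)) ∂(volume.prod μ) := by
    rw [← ofReal_integral_eq_lintegral_ofReal hi (.of_forall hf.nonneg),
      ← ofReal_integral_eq_lintegral_ofReal hie
        (.of_forall fun p => mul_nonneg (hf.nonneg p) (exp_pos _).le)]
    refine ENNReal.ofReal_le_ofReal ?_
    calc ∫ p, f p ∂(volume.prod μ) = ∫ p, (f p * L p + f p) ∂(volume.prod μ) := by
          rw [integral_add hiL hi, hL0, zero_add]
      _ ≤ ∫ p, f p * exp (L p) ∂(volume.prod μ) := by
          refine integral_mono (hiL.add hi) hie fun p => ?_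
          have := mul_le_mul_of_nonneg_left (Real.add_one_le_exp (L p)) (hf.nonneg p)
          simp only
          linarith
  refine (mul_le_mul_left hmono _).trans ?_
  rw [← lintegral_congr hcut]
  refine hz _ (hf.measurable.mul (Real.continuous_exp.comp hLc).measurable).ennreal_ofReal
    fun p q => ?_
  rw [hcut, ENNReal.ofReal_mul (hf.nonneg p), mul_right_comm]
  refine (mul_le_mul_left ((mul_le_mul_right (cutoff_le N g _) _).trans (hfg _ _)) _).trans_eq ?_
  rw [← ENNReal.ofReal_mul (exp_pos _).le, ← Real.exp_add]
  simp only [hL, Prod.fst_add, Prod.snd_add, map_add]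
  congr 2
  ring

end step

/-- The Santaló inequality is transported by measure preserving linear isomorphisms. -/
theorem SantaloBound.comp_continuousLinearEquiv {E E' : Type*} [NormedAddCommGroup E]
    [NormedSpace ℝ E] [MeasurableSpace E] [BorelSpace E] [NormedAddCommGroup E']
    [NormedSpace ℝ E'] [FiniteDimensional ℝ E'] [MeasurableSpace E'] [BorelSpace E']
    {μ : Measure E} {ν : Measure E'} [IsFiniteMeasureOnCompacts ν] {B : E → E → ℝ} {c : ℝ≥0∞}
    (hQ : SantaloBound μ B c) (e : E' ≃L[ℝ] E) (he : MeasurePreserving e ν μ) :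
    SantaloBound ν (fun x y => B (e x) (e y)) c := by
  intro f g hf hg hf0 hfg
  have hsymm : Measurable e.symm := e.symm.continuous.measurable
  have hge : Measurable fun y => g (e.symm y) := hg.comp hsymm
  have : FiniteDimensional ℝ E := e.toLinearEquiv.finiteDimensional
  have := FiniteDimensional.complete ℝ E
  have := FiniteDimensional.proper_real E
  have hfe : IsTame fun y => f (e.symm y) :=
    { measurable := hf.measurable.comp hsymm
      nonneg := fun _ => hf.nonneg _
      bounded := hf.bounded.imp fun _ h _ => h _
      support := by
        obtain ⟨R, hR⟩ := hf.support
        refine ⟨‖(e : E' →L[ℝ] E)‖ * R, fun y hy => ?_⟩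
        have h := (e : E' →L[ℝ] E).le_opNorm_of_le (hR _ hy)
        simpa using h }
  have h1 : ∫⁻ y, ENNReal.ofReal (f (e.symm y)) ∂μ = ∫⁻ x, ENNReal.ofReal (f x) ∂ν := by
    rw [← he.lintegral_comp hfe.measurable.ennreal_ofReal]
    simp only [e.symm_apply_apply]
  have h2 : ∫⁻ y, g (e.symm y) ∂μ = ∫⁻ x, g x ∂ν := by
    rw [← he.lintegral_comp hge]
    simp only [e.symm_apply_apply]
  have h3 : ∫ y, f (e.symm y) • y ∂μ = 0 := by
    have hm : AEStronglyMeasurable (fun y => f (e.symm y) • y) μ :=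
      (hfe.measurable.smul measurable_id).aestronglyMeasurable
    have h := (e : E' →L[ℝ] E).integral_comp_comm (hf.integrable_smul ν continuous_id)
    simp only [id, hf0, map_zero, map_smul, ContinuousLinearEquiv.coe_coe] at h
    rw [← he.integral_comp_of_aestronglyMeasurable hm]
    simpa only [e.symm_apply_apply] using h
  have := hQ _ _ hfe hge h3 fun x y => by
    simpa using hfg (e.symm x) (e.symm y)
  rwa [h1, h2] at this

/-- The functional Santaló inequality on `ℝ^m`. -/
theorem santaloBound_pi_real (m : ℕ) :
    SantaloBound (volume : Measure (Fin m → ℝ)) (fun x y => ∑ i, x i * y i)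
      (ENNReal.ofReal (2 * π) ^ m) := by
  induction m with
  | zero =>
    intro f g hf hg _ hfg
    rw [Measure.volume_pi_eq_dirac, lintegral_dirac' _ hf.measurable.ennreal_ofReal,
      lintegral_dirac' _ hg]
    simpa using hfg _ _
  | succ m ih =>
    let B : (Fin m → ℝ) →L[ℝ] (Fin m → ℝ) →L[ℝ] ℝ :=
      ∑ i, (ContinuousLinearMap.mul ℝ ℝ).bilinearComp
        (ContinuousLinearMap.proj (R := ℝ) (φ := fun _ : Fin m => ℝ) i)
        (ContinuousLinearMap.proj (R := ℝ) (φ := fun _ : Fin m => ℝ) i)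
    have hB : ∀ x y, B x y = ∑ i, x i * y i := fun x y => by
      simp [B]
    have hQ : SantaloBound (volume : Measure (Fin m → ℝ)) (fun x y => B x y)
        (ENNReal.ofReal (2 * π) ^ m) := by simpa only [hB] using ih
    have hstep := (hQ.real_prod fun x y => by simp only [hB, mul_comm]).comp_continuousLinearEquiv
      (Fin.consEquivL ℝ fun _ : Fin (m + 1) => ℝ).symm
      (volume_preserving_piFinSuccAbove (fun _ : Fin (m + 1) => ℝ) 0)
    simp only [hB] at hstep
    simp only [Fin.sum_univ_succ, pow_succ']
    exact hstep

/-- Concatenation of `n` vectors of `ℝ^d`. -/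
noncomputable def concatEquiv (n d : ℕ) :
    (Fin n → EuclideanSpace ℝ (Fin d)) ≃L[ℝ] (Fin (n * d) → ℝ) :=
  LinearEquiv.toContinuousLinearEquiv
    { toFun := fun x k => x (finProdFinEquiv.symm k).1 (finProdFinEquiv.symm k).2
      invFun := fun y i => WithLp.toLp 2 fun j => y (finProdFinEquiv (i, j))
      map_add' := fun _ _ => rfl
      map_smul' := fun _ _ => rfl
      left_inv := fun x => by ext; simp
      right_inv := fun y => by ext k; exact congrArg y (finProdFinEquiv.apply_symm_apply k) }

theorem concatEquiv_apply {n d : ℕ} (x : Fin n → EuclideanSpace ℝ (Fin d)) (k : Fin (n * d)) :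
    concatEquiv n d x k = x (finProdFinEquiv.symm k).1 (finProdFinEquiv.symm k).2 := rfl

theorem measurePreserving_concatEquiv (n d : ℕ) :
    MeasurePreserving (concatEquiv n d) volume volume := by
  have hm : Measurable (concatEquiv n d) := (concatEquiv n d).continuous.measurable
  refine ⟨hm, ?_⟩
  rw [volume_pi (ι := Fin (n * d))]
  refine (Measure.pi_eq fun s hs => ?_).symm
  have hpre : concatEquiv n d ⁻¹' Set.univ.pi s = Set.univ.pi fun i =>
      WithLp.ofLp ⁻¹' Set.univ.pi fun j => s (finProdFinEquiv (i, j)) := by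
    ext x
    simp only [Set.mem_preimage, Set.mem_pi, Set.mem_univ, forall_const, concatEquiv_apply]
    refine ⟨fun h i j => by simpa using h (finProdFinEquiv (i, j)), fun h k => ?_⟩
    have hk := h (finProdFinEquiv.symm k).1 (finProdFinEquiv.symm k).2
    rwa [Prod.mk.eta, finProdFinEquiv.apply_symm_apply] at hk
  rw [Measure.map_apply hm (MeasurableSet.univ_pi hs), hpre, volume_pi_pi,
    ← finProdFinEquiv.prod_comp, Fintype.prod_prod_type]
  refine Finset.prod_congr rfl fun i _ => ?_
  rw [(PiLp.volume_preserving_ofLp (Fin d)).measure_preimage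
    (MeasurableSet.univ_pi fun j => hs _).nullMeasurableSet, volume_pi_pi]

/-- The functional Santaló inequality on `(ℝ^d)^n`. -/
theorem santaloBound_pi_euclidean (n d : ℕ) :
    SantaloBound (volume : Measure (Fin n → EuclideanSpace ℝ (Fin d)))
      (fun x y => ∑ i, inner ℝ (x i) (y i)) (ENNReal.ofReal (2 * π) ^ (n * d)) := by
  have h := (santaloBound_pi_real (n * d)).comp_continuousLinearEquiv (concatEquiv n d)
    (measurePreserving_concatEquiv n d)
  have hB : ∀ x y : Fin n → EuclideanSpace ℝ (Fin d),
      ∑ k, concatEquiv n d x k * concatEquiv n d y k = ∑ i, inner ℝ (x i) (y i) := by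
    intro x y
    rw [← finProdFinEquiv.sum_comp, Fintype.sum_prod_type]
    refine Finset.sum_congr rfl fun i _ => ?_
    simp [concatEquiv_apply, PiLp.inner_apply, mul_comm]
  simpa only [hB] using h

/-- Santaló inequality for even, not necessarily tame, functions. -/
theorem SantaloBound.of_even {E : Type*} [NormedAddCommGroup E] [NormedSpace ℝ E]
    [MeasurableSpace E] [BorelSpace E] {μ : Measure E} [μ.IsNegInvariant] {B : E → E → ℝ}
    {c : ℝ≥0∞} (hQ : SantaloBound μ B c) {f g : E → ℝ≥0∞} (hf : Measurable f)
    (hg : Measurable g) (heven : ∀ x, f (-x) = f x)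
    (hfg : ∀ x y, f x * g y ≤ ENNReal.ofReal (exp (-B x y))) :
    (∫⁻ x, f x ∂μ) * ∫⁻ y, g y ∂μ ≤ c := by
  rw [lintegral_eq_iSup_cutoff hf, ENNReal.iSup_mul]
  refine iSup_le fun N => ?_
  have hcut : ∀ x, ENNReal.ofReal (cutoff N f x).toReal = cutoff N f x := fun x =>
    ENNReal.ofReal_toReal (cutoff_ne_top N f x)
  rw [← lintegral_congr hcut]
  refine hQ _ g (isTame_toReal_cutoff hf N) hg ?_ fun x y => ?_
  · have h := integral_neg_eq_self (fun x => (cutoff N f x).toReal • x) μ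
    have hodd : ∀ x, cutoff N f (-x) = cutoff N f x := fun x => by
      simp only [cutoff, norm_neg, heven]
    simp only [hodd, smul_neg, integral_neg] at h
    have := IsAddTorsionFree.of_isTorsionFree ℝ E
    exact self_eq_neg.1 h.symm
  · rw [hcut]
    exact (mul_le_mul_left (cutoff_le N f x) _).trans (hfg x y)

theorem lintegral_fin_prod_eq_prod {α : Type*} [MeasurableSpace α] (μ : Measure α)
    [SigmaFinite μ] {n : ℕ} {f : Fin n → α → ℝ≥0∞} (hf : ∀ i, Measurable (f i)) :
    ∫⁻ x, ∏ i, f i (x i) ∂(Measure.pi fun _ => μ) = ∏ i, ∫⁻ a, f i a ∂μ := by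
  induction n with
  | zero => simp
  | succ n ih =>
    have hm : Measurable fun x : Fin n → α => ∏ i, f i.succ (x i) :=
      Finset.measurable_prod _ fun i _ => (hf _).comp (measurable_pi_apply i)
    rw [Fin.prod_univ_succ, ← ih fun i => hf i.succ, ← lintegral_prod_mul (hf 0).aemeasurable
      hm.aemeasurable]
    have hmul : Measurable fun z : α × (Fin n → α) => f 0 z.1 * ∏ i, f i.succ (z.2 i) :=
      ((hf 0).comp measurable_fst).mul (hm.comp measurable_snd)
    simp only [Fin.prod_univ_succ]
    exact (measurePreserving_piFinSuccAbove (fun _ : Fin (n + 1) => μ) 0).lintegral_comp hmul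

theorem pi_withDensity {α : Type*} [MeasurableSpace α] (μ : Measure α) [SigmaFinite μ]
    (n : ℕ) {ρ : α → ℝ≥0∞} (hρ : Measurable ρ) [SigmaFinite (μ.withDensity ρ)] :
    Measure.pi (fun _ : Fin n => μ.withDensity ρ) =
      (Measure.pi fun _ : Fin n => μ).withDensity fun x => ∏ i, ρ (x i) := by
  refine Measure.pi_eq fun s hs => ?_
  have hS := MeasurableSet.univ_pi hs
  rw [withDensity_apply _ hS, ← lintegral_indicator hS]
  have h : ∀ x : Fin n → α, (Set.univ.pi s).indicator (fun x => ∏ i, ρ (x i)) x =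
      ∏ i, (s i).indicator ρ (x i) := by
    intro x
    by_cases hx : x ∈ Set.univ.pi s
    · rw [Set.indicator_of_mem hx]
      exact Finset.prod_congr rfl fun i _ => (Set.indicator_of_mem (hx i trivial) _).symm
    · rw [Set.indicator_of_notMem hx]
      simp only [Set.mem_pi, Set.mem_univ, forall_const, not_forall] at hx
      obtain ⟨i, hi⟩ := hx
      exact (Finset.prod_eq_zero (Finset.mem_univ i) (Set.indicator_of_notMem hi _)).symm
  rw [lintegral_congr h, lintegral_fin_prod_eq_prod μ fun i => hρ.indicator (hs i)]
  refine Finset.prod_congr rfl fun i _ => ?_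
  rw [lintegral_indicator (hs i), withDensity_apply _ (hs i)]

section blocks

variable {d n : ℕ} {C ε : ℝ} {f : (Fin n → EuclideanSpace ℝ (Fin d)) → ℝ}

theorem memFn.abs_sub_le (hf : memFn C ε f) (x y : Fin n → EuclideanSpace ℝ (Fin d)) :
    |f x - f y| ≤ (C * ε).toNNReal * ∑ i, ‖x i - y i‖ := by
  have key : ∀ s : Finset (Fin n),
      |f (s.piecewise x y) - f y| ≤ (C * ε).toNNReal * ∑ i ∈ s, ‖x i - y i‖ := by
    intro s
    induction s using Finset.induction_on with
    | empty => simp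
    | insert j s hj ih =>
      have h1 := (hf j (s.piecewise x y)).1.dist_le_mul (x j) (y j)
      have h2 : Function.update (s.piecewise x y) j (y j) = s.piecewise x y := by
        conv_lhs => rw [← Finset.piecewise_eq_of_notMem s x y hj]
        exact Function.update_eq_self _ _
      rw [h2, ← Finset.piecewise_insert, Real.dist_eq, dist_eq_norm] at h1
      rw [Finset.sum_insert hj, mul_add]
      exact (_root_.abs_sub_le _ _ _).trans (add_le_add h1 ih)
  simpa using key Finset.univ

theorem memFn.continuous (hf : memFn C ε f) : Continuous f := by
  refine (LipschitzWith.of_dist_le_mul (K := (C * ε).toNNReal * n) fun x y => ?_).continuous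
  rw [Real.dist_eq, NNReal.coe_mul, mul_assoc]
  refine (hf.abs_sub_le x y).trans (mul_le_mul_of_nonneg_left ?_ NNReal.zero_le_coe)
  calc ∑ i, ‖x i - y i‖ ≤ ∑ _i : Fin n, dist x y :=
        Finset.sum_le_sum fun i _ => by
          rw [← dist_eq_norm]
          exact dist_le_pi_dist x y i
    _ = ((n : NNReal) : ℝ) * dist x y := by simp

theorem memFn.bddBelow (hf : memFn C ε f) (x : Fin n → EuclideanSpace ℝ (Fin d)) :
    BddBelow (Set.range fun w : Fin n → EuclideanSpace ℝ (Fin d) =>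
      f (x + w) + (∑ i, ‖w i‖ ^ 2) / 2) := by
  set L : ℝ := ((C * ε).toNNReal : ℝ)
  refine ⟨f x - ∑ _i : Fin n, L ^ 2 / 2, ?_⟩
  rintro _ ⟨w, rfl⟩
  have h1 := (abs_le.1 (hf.abs_sub_le (x + w) x)).1
  simp only [Pi.add_apply, add_sub_cancel_left] at h1
  have h2 : L * ∑ i, ‖w i‖ ≤ ∑ _i : Fin n, L ^ 2 / 2 + (∑ i, ‖w i‖ ^ 2) / 2 := by
    rw [Finset.mul_sum, Finset.sum_div, ← Finset.sum_add_distrib]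
    exact Finset.sum_le_sum fun i _ => by nlinarith [sq_nonneg (L - ‖w i‖)]
  simp only
  linarith

theorem memFn.measurable_Hn (hf : memFn C ε f) : Measurable (Hn f) := by
  have hc := hf.continuous
  refine UpperSemicontinuous.measurable (upperSemicontinuous_ciInf hf.bddBelow fun w => ?_)
  exact Continuous.upperSemicontinuous (by fun_prop)

theorem memFn.Hn_le (hf : memFn C ε f) (x y : Fin n → EuclideanSpace ℝ (Fin d)) :
    Hn f y ≤ f x + (∑ i, ‖x i - y i‖ ^ 2) / 2 := by
  have h := ciInf_le (hf.bddBelow y) (x - y)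
  simp only [add_sub_cancel, Pi.sub_apply] at h
  exact h

theorem exp_neg_mul_exp_Hn_le (hf : memFn C ε f) (x y : Fin n → EuclideanSpace ℝ (Fin d)) :
    exp (-(∑ i, ‖x i‖ ^ 2) / 2 - f x) * exp (-(∑ i, ‖y i‖ ^ 2) / 2 + Hn f y) ≤
      exp (-∑ i, inner ℝ (x i) (y i)) := by
  rw [← Real.exp_add, Real.exp_le_exp]
  have h := hf.Hn_le x y
  simp only [norm_sub_sq_real, Finset.sum_add_distrib, Finset.sum_sub_distrib,
    ← Finset.mul_sum] at h
  linarith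

/-- Integration against the product Gaussian in terms of Lebesgue measure. -/
theorem lintegral_pi_stdGauss {u : (Fin n → EuclideanSpace ℝ (Fin d)) → ℝ} (hu : Measurable u) :
    ∫⁻ x, ENNReal.ofReal (exp (u x)) ∂(Measure.pi fun _ => stdGauss d) =
      ENNReal.ofReal ((2 * π) ^ (-(d : ℝ) / 2)) ^ n *
        ∫⁻ x : Fin n → EuclideanSpace ℝ (Fin d),
          ENNReal.ofReal (exp (-(∑ i, ‖x i‖ ^ 2) / 2 + u x)) := by
  have hρ : Measurable fun x : EuclideanSpace ℝ (Fin d) =>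
      ENNReal.ofReal ((2 * π) ^ (-(d : ℝ) / 2) * Real.exp (-‖x‖ ^ 2 / 2)) := by fun_prop
  have hprod : Measurable fun x : Fin n → EuclideanSpace ℝ (Fin d) => ∏ i,
      ENNReal.ofReal ((2 * π) ^ (-(d : ℝ) / 2) * Real.exp (-‖x i‖ ^ 2 / 2)) :=
    Finset.measurable_prod _ fun i _ => hρ.comp (measurable_pi_apply i)
  have hsum : Measurable fun x : Fin n → EuclideanSpace ℝ (Fin d) =>
      ENNReal.ofReal (exp (-(∑ i, ‖x i‖ ^ 2) / 2 + u x)) := by fun_prop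
  unfold stdGauss
  rw [pi_withDensity _ n hρ, lintegral_withDensity_eq_lintegral_mul _ hprod (by fun_prop),
    ← lintegral_const_mul _ hsum]
  refine lintegral_congr fun x => ?_
  have ha : (0 : ℝ) ≤ (2 * π) ^ (-(d : ℝ) / 2) := by positivity
  simp only [Pi.mul_apply, ENNReal.ofReal_mul ha, Finset.prod_mul_distrib, Finset.prod_const,
    Finset.card_univ, Fintype.card_fin, mul_assoc]
  rw [← ENNReal.ofReal_prod_of_nonneg fun i _ => (exp_pos _).le, ← Real.exp_sum,
    ← ENNReal.ofReal_mul (exp_pos _).le, ← Real.exp_add, ← Finset.sum_div,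
    Finset.sum_neg_distrib]

/-- The Gaussian infimum-convolution inequality for even functions. -/
theorem memFn.lintegral_mul_lintegral_le_one (hf : memFn C ε f) (heven : ∀ x, f (-x) = f x) :
    (∫⁻ x, ENNReal.ofReal (Real.exp (-f x)) ∂Measure.pi fun _ => stdGauss d) *
      (∫⁻ x, ENNReal.ofReal (Real.exp (Hn f x)) ∂Measure.pi fun _ => stdGauss d) ≤ 1 := by
  have hfm : Measurable f := hf.continuous.measurable
  have hHm := hf.measurable_Hn
  have : (volume : Measure (Fin n → EuclideanSpace ℝ (Fin d))).IsNegInvariant :=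
    Measure.pi.isNegInvariant _
  have h := (santaloBound_pi_euclidean n d).of_even
    (f := fun x => ENNReal.ofReal (exp (-(∑ i, ‖x i‖ ^ 2) / 2 + -f x)))
    (g := fun y => ENNReal.ofReal (exp (-(∑ i, ‖y i‖ ^ 2) / 2 + Hn f y)))
    (by fun_prop) (by fun_prop) (by simp [heven]) fun x y => by
      rw [← ENNReal.ofReal_mul (exp_pos _).le, ← sub_eq_add_neg]
      exact ENNReal.ofReal_le_ofReal (exp_neg_mul_exp_Hn_le hf x y)
  have hconst : (2 * π) ^ (-(d : ℝ) / 2) * (2 * π) ^ (-(d : ℝ) / 2) * (2 * π) ^ d = 1 := by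
    rw [← Real.rpow_natCast, ← Real.rpow_add (by positivity), ← Real.rpow_add (by positivity)]
    ring_nf
    simp
  rw [lintegral_pi_stdGauss (u := fun x => -f x) hfm.neg, lintegral_pi_stdGauss hHm,
    mul_mul_mul_comm]
  refine (mul_le_mul_right h _).trans_eq ?_
  rw [← mul_pow, mul_comm n d, pow_mul, ← mul_pow, ← ENNReal.ofReal_pow (by positivity),
    ← ENNReal.ofReal_mul (by positivity), ← ENNReal.ofReal_mul (by positivity), hconst,
    ENNReal.ofReal_one, one_pow]

end blocks

/-- Tensorised "small ε" inequality: for every `C > 0` there is a constant `K`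
depending only on `C` such that for every `ε ∈ (0,1]`, every `n ≥ 1` and every even
`f ∈ F_n(C,ε)`, with `X₁,…,X_n` independent standard Gaussian vectors on `ℝ^d`,
`E[e^{-f(X₁,…,X_n)}] E[e^{Hf(X₁,…,X_n)}] ≤ (1 + Kε³)^n`. -/
theorem tensorised_small_epsilon (C : ℝ) (hC : 0 < C) :
    ∃ K : ℝ, ∀ (d n : ℕ), 1 ≤ n → ∀ ε : ℝ, ε ∈ Set.Ioc (0 : ℝ) 1 →
      ∀ f : (Fin n → EuclideanSpace ℝ (Fin d)) → ℝ,
        memFn C ε f → (∀ x, f (-x) = f x) →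
        (∫⁻ x, ENNReal.ofReal (Real.exp (-f x)) ∂Measure.pi fun _ => stdGauss d) *
          (∫⁻ x, ENNReal.ofReal (Real.exp (Hn f x)) ∂Measure.pi fun _ => stdGauss d) ≤
          ENNReal.ofReal ((1 + K * ε ^ 3) ^ n) := by
  refine ⟨0, fun d n _ ε _ f hf heven => ?_⟩
  simpa using hf.lintegral_mul_lintegral_le_one heven
end

section
/- For every C > 0 there exists a constant K depending only on C such that for every ε ∈ (0,1] and every function f ∈ F(C,ε) (not necessarily even), E[e^{−f(X)}] · E[e^{(f ⊡ (c/4))(X)}] ≤ 1 + K ε³, where X is a standard Gaussian vector on ℝ^d and c(x) = |x|². -/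
open MeasureTheory Real

/-- The infimum convolution with the quarter-quadratic cost:
`(f ⊡ c/4)(x) = inf_y ( f(x+y) + |y|²/4 )`. -/
noncomputable def infConvQuarter {E : Type*} [NormedAddCommGroup E]
    (f : E → ℝ) (x : E) : ℝ :=
  ⨅ y : E, (f (x + y) + ‖y‖ ^ 2 / 4)

open scoped ENNReal NNReal

/-- One-dimensional Brunn–Minkowski inequality for compact sets, in midpoint form. -/
theorem volume_add_volume_le_of_isCompact {K L D : Set ℝ} (hK : IsCompact K) (hL : IsCompact L)
    (hKne : K.Nonempty) (hLne : L.Nonempty)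
    (hD : ∀ x ∈ K, ∀ y ∈ L, (x + y) * 2⁻¹ ∈ D) :
    volume K + volume L ≤ 2 * volume D := by
  obtain ⟨a, haK, ha⟩ := hK.exists_isGreatest hKne
  obtain ⟨b, hbL, hb⟩ := hL.exists_isLeast hLne
  have hscale : volume ((fun x : ℝ => x * 2⁻¹) ⁻¹' D) = 2 * volume D := by
    rw [Real.volume_preimage_mul_right (by norm_num)]
    norm_num
  have hKb : volume ((fun x : ℝ => x + -b) ⁻¹' K) = volume K := measure_preimage_add_right _ _ _
  have haL : volume ((fun x : ℝ => x + -a) ⁻¹' L) = volume L := measure_preimage_add_right _ _ _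
  have hdisj : AEDisjoint volume ((fun x : ℝ => x + -b) ⁻¹' K) ((fun x : ℝ => x + -a) ⁻¹' L) := by
    refine measure_mono_null (t := {a + b}) ?_ (by simp)
    rintro x ⟨hxK, hxL⟩
    have h₁ := ha hxK
    have h₂ := hb hxL
    simp only [Set.mem_singleton_iff]
    linarith
  have hmeas : NullMeasurableSet ((fun x : ℝ => x + -a) ⁻¹' L) volume :=
    (hL.measurableSet.preimage (by fun_prop)).nullMeasurableSet
  rw [← hscale, ← hKb, ← haL, ← measure_union₀ hmeas hdisj]
  refine measure_mono ?_
  rintro x (hx | hx)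
  · have := hD _ hx _ hbL
    simpa using this
  · have := hD _ haK _ hx
    simpa using this

/-- One-dimensional Brunn–Minkowski inequality, in midpoint form. -/
theorem volume_add_volume_le {A B D : Set ℝ} (hA : MeasurableSet A) (hB : MeasurableSet B)
    (hAne : A.Nonempty) (hBne : B.Nonempty)
    (hD : ∀ x ∈ A, ∀ y ∈ B, (x + y) * 2⁻¹ ∈ D) :
    volume A + volume B ≤ 2 * volume D := by
  obtain ⟨a, ha⟩ := hAne
  obtain ⟨b, hb⟩ := hBne
  have hcompact : ∀ K ⊆ A, IsCompact K → ∀ L ⊆ B, IsCompact L →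
      volume K + volume L ≤ 2 * volume D := by
    intro K hKA hK L hLB hL
    refine (add_le_add (measure_mono (Set.subset_insert a K))
      (measure_mono (Set.subset_insert b L))).trans ?_
    exact volume_add_volume_le_of_isCompact (hK.insert a) (hL.insert b) (Set.insert_nonempty _ _)
      (Set.insert_nonempty _ _) fun x hx y hy =>
        hD x (Set.insert_subset ha hKA hx) y (Set.insert_subset hb hLB hy)
  have hleft : ∀ L ⊆ B, IsCompact L → volume A + volume L ≤ 2 * volume D := by
    intro L hLB hL
    have hfin : volume L ≠ ∞ := hL.measure_lt_top.ne
    have hle : volume A ≤ 2 * volume D - volume L := by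
      rw [hA.measure_eq_iSup_isCompact]
      exact iSup₂_le fun K hKA => iSup_le fun hK =>
        ENNReal.le_sub_of_add_le_right hfin (hcompact K hKA hK L hLB hL)
    calc volume A + volume L ≤ (2 * volume D - volume L) + volume L := by gcongr
      _ = 2 * volume D := tsub_add_cancel_of_le
          (le_add_self.trans (hcompact ∅ (Set.empty_subset _) isCompact_empty L hLB hL))
  have hA_le : volume A ≤ 2 * volume D := by
    simpa using hleft ∅ (Set.empty_subset _) isCompact_empty
  by_cases hfin : volume A = ∞
  · rw [hfin, top_le_iff] at hA_le
    exact hA_le ▸ le_top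
  have hle : volume B ≤ 2 * volume D - volume A := by
    rw [hB.measure_eq_iSup_isCompact]
    exact iSup₂_le fun L hLB => iSup_le fun hL =>
      ENNReal.le_sub_of_add_le_left hfin (hleft L hLB hL)
  calc volume A + volume B ≤ volume A + (2 * volume D - volume A) := by gcongr
    _ = 2 * volume D := add_tsub_cancel_of_le hA_le

/-- The additive form of the one-dimensional Prékopa–Leindler inequality, for functions
with supremum one. -/
theorem lintegral_add_lintegral_le_of_isLUB {u v w : ℝ → ℝ} (hu : Measurable u)
    (hv : Measurable v) (hw : Measurable w) (hu₀ : ∀ x, 0 ≤ u x) (hv₀ : ∀ x, 0 ≤ v x)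
    (hw₀ : ∀ x, 0 ≤ w x) (hu₁ : IsLUB (Set.range u) 1) (hv₁ : IsLUB (Set.range v) 1)
    (huvw : ∀ x y, u x * v y ≤ w ((x + y) * 2⁻¹) ^ 2) :
    (∫⁻ x, ENNReal.ofReal (u x)) + (∫⁻ x, ENNReal.ofReal (v x)) ≤
      2 * ∫⁻ x, ENNReal.ofReal (w x) := by
  have hlayer : ∀ {g : ℝ → ℝ}, Measurable g → (∀ x, 0 ≤ g x) →
      ∫⁻ x, ENNReal.ofReal (g x) = ∫⁻ t in Set.Ioi 0, volume {x | t < g x} := fun hg hg₀ =>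
    lintegral_eq_lintegral_meas_lt _ (Filter.Eventually.of_forall hg₀) hg.aemeasurable
  have hanti : ∀ g : ℝ → ℝ, Measurable fun t : ℝ => volume {x | t < g x} := fun g =>
    Antitone.measurable fun s t hst => measure_mono fun x hx => lt_of_le_of_lt hst hx
  rw [hlayer hu hu₀, hlayer hv hv₀, hlayer hw hw₀, ← lintegral_add_left (hanti u),
    ← lintegral_const_mul _ (hanti w)]
  refine setLIntegral_mono ((hanti w).const_mul 2) fun t ht => ?_
  rcases lt_or_ge t 1 with h1 | h1
  · obtain ⟨_, ⟨a, rfl⟩, ha, -⟩ := hu₁.exists_between h1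
    obtain ⟨_, ⟨b, rfl⟩, hb, -⟩ := hv₁.exists_between h1
    refine volume_add_volume_le (measurableSet_lt measurable_const hu)
      (measurableSet_lt measurable_const hv) ⟨a, ha⟩ ⟨b, hb⟩ fun x hx y hy => ?_
    refine lt_of_pow_lt_pow_left₀ 2 (hw₀ _) (lt_of_lt_of_le ?_ (huvw x y))
    have ht₀ : 0 < t := ht
    rw [pow_two]
    exact mul_lt_mul'' hx hy ht₀.le ht₀.le
  · have hempty : ∀ {g : ℝ → ℝ}, IsLUB (Set.range g) 1 → {x | t < g x} = ∅ := fun hg =>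
      Set.eq_empty_of_forall_notMem fun x hx =>
        absurd (hg.1 ⟨x, rfl⟩) (not_le.2 (lt_of_le_of_lt h1 hx))
    simp [hempty hu₁, hempty hv₁]

/-- One-dimensional Prékopa–Leindler inequality for bounded functions. -/
theorem lintegral_mul_lintegral_le_of_bddAbove {u v w : ℝ → ℝ} (hu : Measurable u)
    (hv : Measurable v) (hw : Measurable w) (hu₀ : ∀ x, 0 ≤ u x) (hv₀ : ∀ x, 0 ≤ v x)
    (hw₀ : ∀ x, 0 ≤ w x) (hub : BddAbove (Set.range u)) (hvb : BddAbove (Set.range v))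
    (huvw : ∀ x y, u x * v y ≤ w ((x + y) * 2⁻¹) ^ 2) :
    (∫⁻ x, ENNReal.ofReal (u x)) * (∫⁻ x, ENNReal.ofReal (v x)) ≤
      (∫⁻ x, ENNReal.ofReal (w x)) ^ 2 := by
  have hMlub := isLUB_ciSup hub
  have hNlub := isLUB_ciSup hvb
  set M := ⨆ x, u x
  set N := ⨆ x, v x
  have huM : ∀ x, u x ≤ M := fun x => hMlub.1 ⟨x, rfl⟩
  have hvN : ∀ x, v x ≤ N := fun x => hNlub.1 ⟨x, rfl⟩
  rcases ((hu₀ 0).trans (huM 0)).eq_or_lt with hM | hM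
  · have : ∀ x, u x = 0 := fun x => le_antisymm (hM ▸ huM x) (hu₀ x)
    simp [this]
  rcases ((hv₀ 0).trans (hvN 0)).eq_or_lt with hN | hN
  · have : ∀ x, v x = 0 := fun x => le_antisymm (hN ▸ hvN x) (hv₀ x)
    simp [this]
  have hlub : ∀ {g : ℝ → ℝ} {R : ℝ}, 0 < R → IsLUB (Set.range g) R →
      IsLUB (Set.range fun x => R⁻¹ * g x) 1 := by
    intro g R hR hg
    have := hg.mul_left (inv_nonneg.2 hR.le)
    rwa [inv_mul_cancel₀ hR.ne', ← Set.range_comp] at this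
  set S := √(M * N)
  have hS : 0 < S := Real.sqrt_pos.2 (mul_pos hM hN)
  have hS2 : S ^ 2 = M * N := Real.sq_sqrt (mul_pos hM hN).le
  have key := lintegral_add_lintegral_le_of_isLUB (hu.const_mul M⁻¹) (hv.const_mul N⁻¹)
    (hw.const_mul S⁻¹) (fun x => mul_nonneg (inv_nonneg.2 hM.le) (hu₀ x))
    (fun x => mul_nonneg (inv_nonneg.2 hN.le) (hv₀ x))
    (fun x => mul_nonneg (inv_nonneg.2 hS.le) (hw₀ x)) (hlub hM hMlub) (hlub hN hNlub)
    (fun x y => by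
      rw [mul_pow, inv_pow, hS2, mul_inv]
      calc M⁻¹ * u x * (N⁻¹ * v y) = M⁻¹ * N⁻¹ * (u x * v y) := by ring
        _ ≤ _ := by gcongr; exact huvw x y)
  have hconst : ∀ {g : ℝ → ℝ} {R : ℝ}, 0 < R → Measurable g →
      ∫⁻ x, ENNReal.ofReal (R⁻¹ * g x) = ENNReal.ofReal R⁻¹ * ∫⁻ x, ENNReal.ofReal (g x) := by
    intro g R hR hg
    rw [← lintegral_const_mul _ hg.ennreal_ofReal]
    exact lintegral_congr fun x => ENNReal.ofReal_mul (inv_nonneg.2 hR.le)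
  rw [hconst hM hu, hconst hN hv, hconst hS hw] at key
  generalize (∫⁻ x, ENNReal.ofReal (u x)) = a at *
  generalize (∫⁻ x, ENNReal.ofReal (v x)) = b at *
  generalize (∫⁻ x, ENNReal.ofReal (w x)) = c at *
  by_cases hc : c = ∞
  · simp [hc]
  have hrhs : 2 * (ENNReal.ofReal S⁻¹ * c) ≠ ∞ :=
    ENNReal.mul_ne_top (by simp) (ENNReal.mul_ne_top ENNReal.ofReal_ne_top hc)
  have hfin : ∀ {R : ℝ} {z : ℝ≥0∞}, 0 < R → ENNReal.ofReal R⁻¹ * z ≠ ∞ → z ≠ ∞ := by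
    intro R z hR h hz
    rw [hz, ENNReal.mul_top (by simpa using hR)] at h
    exact h rfl
  have ha : a ≠ ∞ := hfin hM (ne_top_of_le_ne_top hrhs (le_self_add.trans key))
  have hb : b ≠ ∞ := hfin hN (ne_top_of_le_ne_top hrhs (le_add_self.trans key))
  lift a to ℝ≥0 using ha
  lift b to ℝ≥0 using hb
  lift c to ℝ≥0 using hc
  have hkey : M⁻¹ * (a : ℝ) + N⁻¹ * b ≤ 2 * (S⁻¹ * c) := by
    have h := ENNReal.toReal_mono hrhs key
    rw [ENNReal.toReal_add (by finiteness) (by finiteness)] at h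
    simpa [ENNReal.toReal_ofReal, hM.le, hN.le, hS.le] using h
  have hreal : (a : ℝ) * b ≤ (c : ℝ) ^ 2 := by
    have hp : 0 ≤ M⁻¹ * (a : ℝ) := by positivity
    have hq : 0 ≤ N⁻¹ * (b : ℝ) := by positivity
    have hsq : (M⁻¹ * (a : ℝ)) * (N⁻¹ * b) ≤ (S⁻¹ * c) ^ 2 := by
      nlinarith [sq_nonneg (M⁻¹ * (a : ℝ) - N⁻¹ * b), pow_le_pow_left₀ (add_nonneg hp hq) hkey 2]
    have hab : (a : ℝ) * b = M * N * ((M⁻¹ * (a : ℝ)) * (N⁻¹ * b)) := by field_simp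
    have hcc : (c : ℝ) ^ 2 = M * N * (S⁻¹ * c) ^ 2 := by rw [← hS2]; field_simp
    rw [hab, hcc]
    gcongr
  exact_mod_cast hreal

/-- One-dimensional Prékopa–Leindler inequality. -/
theorem lintegral_mul_lintegral_le_real {u v w : ℝ → ℝ≥0∞} (hu : Measurable u)
    (hv : Measurable v) (hw : Measurable w)
    (huvw : ∀ x y, u x * v y ≤ w ((2⁻¹ : ℝ) • (x + y)) ^ 2) :
    (∫⁻ x, u x) * (∫⁻ x, v x) ≤ (∫⁻ x, w x) ^ 2 := by
  have htrunc : ∀ {g : ℝ → ℝ≥0∞}, Measurable g →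
      ∫⁻ x, g x = ⨆ n : ℕ, ∫⁻ x, min (g x) n := by
    intro g hg
    rw [← lintegral_iSup (fun n => hg.min measurable_const)
      (fun m n hmn x => min_le_min_left _ (by exact_mod_cast hmn))]
    refine lintegral_congr fun x => ?_
    rw [← inf_iSup_eq, ENNReal.iSup_natCast, inf_top_eq]
  have hne : ∀ (z : ℝ≥0∞) (n : ℕ), min z n ≠ ∞ := fun z n =>
    ne_top_of_le_ne_top (ENNReal.natCast_ne_top n) (min_le_right _ _)
  have hbdd : ∀ n : ℕ, (∫⁻ x, min (u x) n) * (∫⁻ x, min (v x) n) ≤ (∫⁻ x, w x) ^ 2 := by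
    intro n
    have hbd : ∀ g : ℝ → ℝ≥0∞, BddAbove (Set.range fun x => (min (g x) n).toReal) := by
      rintro g
      refine ⟨n, ?_⟩
      rintro _ ⟨x, rfl⟩
      exact ENNReal.toReal_mono (ENNReal.natCast_ne_top n) (min_le_right _ _)
    have h := lintegral_mul_lintegral_le_of_bddAbove
      (hu.min (measurable_const (a := (n : ℝ≥0∞)))).ennreal_toReal
      (hv.min (measurable_const (a := (n : ℝ≥0∞)))).ennreal_toReal
      (hw.min (measurable_const (a := (n : ℝ≥0∞)))).ennreal_toReal
      (fun _ => ENNReal.toReal_nonneg) (fun _ => ENNReal.toReal_nonneg)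
      (fun _ => ENNReal.toReal_nonneg) (hbd u) (hbd v) (fun x y => by
        rw [← ENNReal.toReal_mul, ← ENNReal.toReal_pow]
        refine ENNReal.toReal_mono (ENNReal.pow_ne_top (hne _ _)) ?_
        have hxy := huvw x y
        rw [smul_eq_mul, mul_comm (2⁻¹ : ℝ)] at hxy
        rcases le_total (w ((x + y) * 2⁻¹)) n with hwn | hwn
        · rw [min_eq_left hwn]
          exact (mul_le_mul' (min_le_left _ _) (min_le_left _ _)).trans hxy
        · rw [min_eq_right hwn, pow_two]
          exact mul_le_mul' (min_le_right _ _) (min_le_right _ _))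
    simp only [ENNReal.ofReal_toReal (hne _ _)] at h
    refine h.trans ?_
    gcongr
    exact min_le_left _ _
  rw [htrunc hu, htrunc hv]
  simp only [ENNReal.iSup_mul, ENNReal.mul_iSup]
  refine iSup₂_le fun i j => (mul_le_mul' (lintegral_mono fun x => min_le_min_left _ ?_)
    (lintegral_mono fun x => min_le_min_left _ ?_)).trans (hbdd (max i j))
  · exact_mod_cast le_max_right i j
  · exact_mod_cast le_max_left i j

/-- **Prékopa–Leindler inequality** at the midpoint, on `Fin n → ℝ`. -/
theorem lintegral_mul_lintegral_le_pi : ∀ {n : ℕ} {u v w : (Fin n → ℝ) → ℝ≥0∞},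
    Measurable u → Measurable v → Measurable w →
    (∀ x y, u x * v y ≤ w ((2⁻¹ : ℝ) • (x + y)) ^ 2) →
    (∫⁻ x, u x) * (∫⁻ x, v x) ≤ (∫⁻ x, w x) ^ 2
  | 0, u, v, w, _, _, _, huvw => by
    have huniv : volume (Set.univ : Set (Fin 0 → ℝ)) = 1 := by
      rw [volume_pi, ← Set.pi_univ Set.univ, Measure.pi_pi]
      simp
    rw [lintegral_unique, lintegral_unique, lintegral_unique, huniv, mul_one, mul_one, mul_one]
    exact (huvw _ _).trans_eq (by congr 2; exact Subsingleton.elim _ _)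
  | n + 1, u, v, w, hu, hv, hw, huvw => by
    have hsymm : ∀ p : ℝ × (Fin n → ℝ), (MeasurableEquiv.piFinSuccAbove
        (fun _ : Fin (n + 1) => ℝ) 0).symm p = (Fin.cons p.1 p.2 : Fin (n + 1) → ℝ) :=
      fun p => Fin.insertNth_zero' p.1 p.2
    have hcons : Measurable fun p : ℝ × (Fin n → ℝ) => (Fin.cons p.1 p.2 : Fin (n + 1) → ℝ) := by
      simpa only [← hsymm] using
        (MeasurableEquiv.piFinSuccAbove (fun _ : Fin (n + 1) => ℝ) 0).symm.measurable
    have hfubini : ∀ {g : (Fin (n + 1) → ℝ) → ℝ≥0∞}, Measurable g →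
        ∫⁻ x, g x = ∫⁻ s : ℝ, ∫⁻ y : Fin n → ℝ, g (Fin.cons s y) := by
      intro g hg
      have hmp := (volume_preserving_piFinSuccAbove (fun _ : Fin (n + 1) => ℝ) 0).symm
      rw [← hmp.lintegral_comp hg, Measure.volume_eq_prod]
      simp only [hsymm]
      exact lintegral_prod _ (hg.comp hcons).aemeasurable
    rw [hfubini hu, hfubini hv, hfubini hw]
    refine lintegral_mul_lintegral_le_real (hu.comp hcons).lintegral_prod_right'
      (hv.comp hcons).lintegral_prod_right' (hw.comp hcons).lintegral_prod_right' fun s t => ?_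
    have hslice : ∀ s : ℝ, Measurable fun y : Fin n → ℝ => (Fin.cons s y : Fin (n + 1) → ℝ) :=
      fun s => hcons.comp measurable_prodMk_left
    refine lintegral_mul_lintegral_le_pi (hu.comp (hslice s)) (hv.comp (hslice t))
      (hw.comp (hslice _)) fun x y => ?_
    refine (huvw _ _).trans_eq ?_
    congr 2
    ext i
    refine Fin.cases ?_ (fun j => ?_) i <;> simp [mul_add]

/-- **Prékopa–Leindler inequality** at the midpoint, on Euclidean space. -/
theorem lintegral_mul_lintegral_le_euclideanSpace {d : ℕ}
    {u v w : EuclideanSpace ℝ (Fin d) → ℝ≥0∞} (hw : Measurable w)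
    (huvw : ∀ x y, u x * v y ≤ w ((2⁻¹ : ℝ) • (x + y)) ^ 2) :
    (∫⁻ x, u x) * (∫⁻ x, v x) ≤ (∫⁻ x, w x) ^ 2 := by
  obtain ⟨u', hu', huu', hu_eq⟩ := exists_measurable_le_lintegral_eq volume u
  obtain ⟨v', hv', hvv', hv_eq⟩ := exists_measurable_le_lintegral_eq volume v
  have hmp := PiLp.volume_preserving_toLp (Fin d)
  rw [hu_eq, hv_eq, ← hmp.lintegral_comp hu', ← hmp.lintegral_comp hv', ← hmp.lintegral_comp hw]
  refine lintegral_mul_lintegral_le_pi (hu'.comp hmp.measurable) (hv'.comp hmp.measurable)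
    (hw.comp hmp.measurable) fun x y => ?_
  exact (mul_le_mul' (huu' _) (hvv' _)).trans (huvw _ _)

/-- The standard Gaussian density has total mass one. -/
theorem lintegral_gaussian_density (d : ℕ) :
    ∫⁻ x : EuclideanSpace ℝ (Fin d),
      ENNReal.ofReal ((2 * π) ^ (-(d : ℝ) / 2) * Real.exp (-‖x‖ ^ 2 / 2)) = 1 := by
  have hint : ∫ x : EuclideanSpace ℝ (Fin d),
      (2 * π) ^ (-(d : ℝ) / 2) * Real.exp (-‖x‖ ^ 2 / 2) = 1 := by
    have h := GaussianFourier.integral_rexp_neg_mul_sq_norm (V := EuclideanSpace ℝ (Fin d))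
      (b := 2⁻¹) (by norm_num)
    have hexp : ∀ x : EuclideanSpace ℝ (Fin d), -‖x‖ ^ 2 / 2 = -2⁻¹ * ‖x‖ ^ 2 := fun x => by ring
    simp_rw [hexp]
    rw [integral_const_mul, h, finrank_euclideanSpace_fin, div_inv_eq_mul, mul_comm π 2,
      ← Real.rpow_add (by positivity)]
    ring_nf
    simp
  rw [← ofReal_integral_eq_lintegral_ofReal, hint, ENNReal.ofReal_one]
  · exact Integrable.of_integral_ne_zero (by rw [hint]; exact one_ne_zero)
  · exact Filter.Eventually.of_forall fun x => by positivity

/-- The quarter-quadratic infimum convolution of a Lipschitz function is bounded by each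
competitor. -/
theorem infConvQuarter_le {E : Type*} [NormedAddCommGroup E] {L : ℝ≥0} {f : E → ℝ}
    (hf : LipschitzWith L f) (x y : E) :
    infConvQuarter f x ≤ f y + ‖y - x‖ ^ 2 / 4 := by
  have hbdd : BddBelow (Set.range fun z : E => f (x + z) + ‖z‖ ^ 2 / 4) := by
    refine ⟨f x - (L : ℝ) ^ 2, ?_⟩
    rintro _ ⟨z, rfl⟩
    have h := hf.dist_le_mul x (x + z)
    rw [Real.dist_eq, dist_self_add_right] at h
    have := le_of_abs_le h
    dsimp only
    nlinarith [sq_nonneg (‖z‖ / 2 - L)]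
  simpa [infConvQuarter] using ciInf_le hbdd (y - x)

/-- **Maurey's property (τ)** for the standard Gaussian measure. -/
theorem lintegral_exp_neg_mul_lintegral_exp_infConvQuarter_le_one {d : ℕ} {L : ℝ≥0}
    {f : EuclideanSpace ℝ (Fin d) → ℝ} (hf : LipschitzWith L f) :
    (∫⁻ x, ENNReal.ofReal (Real.exp (-f x)) ∂stdGauss d) *
      (∫⁻ x, ENNReal.ofReal (Real.exp (infConvQuarter f x)) ∂stdGauss d) ≤ 1 := by
  have hmeas : Measurable fun x : EuclideanSpace ℝ (Fin d) =>
      ENNReal.ofReal ((2 * π) ^ (-(d : ℝ) / 2) * Real.exp (-‖x‖ ^ 2 / 2)) := by fun_prop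
  have hfin : ∀ᵐ x : EuclideanSpace ℝ (Fin d),
      ENNReal.ofReal ((2 * π) ^ (-(d : ℝ) / 2) * Real.exp (-‖x‖ ^ 2 / 2)) < ∞ :=
    Filter.Eventually.of_forall fun _ => ENNReal.ofReal_lt_top
  rw [stdGauss, lintegral_withDensity_eq_lintegral_mul_non_measurable _ hmeas hfin,
    lintegral_withDensity_eq_lintegral_mul_non_measurable _ hmeas hfin]
  refine (lintegral_mul_lintegral_le_euclideanSpace hmeas fun x y => ?_).trans_eq
    (by rw [lintegral_gaussian_density, one_pow])
  simp only [Pi.mul_apply]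
  rw [← ENNReal.ofReal_mul (by positivity), ← ENNReal.ofReal_mul (by positivity),
    ← ENNReal.ofReal_mul (by positivity), ← ENNReal.ofReal_pow (by positivity)]
  refine ENNReal.ofReal_le_ofReal ?_
  generalize ((2 * π) ^ (-(d : ℝ) / 2)) = A
  have hpar := parallelogram_law_with_norm ℝ x y
  have hinf := infConvQuarter_le hf y x
  have hnorm : ‖(2⁻¹ : ℝ) • (x + y)‖ ^ 2 = ‖x + y‖ ^ 2 / 4 := by
    rw [norm_smul, mul_pow]
    norm_num
    ring
  calc A * Real.exp (-‖x‖ ^ 2 / 2) * Real.exp (-f x) *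
        (A * Real.exp (-‖y‖ ^ 2 / 2) * Real.exp (infConvQuarter f y))
      = A ^ 2 * Real.exp (-‖x‖ ^ 2 / 2 + -f x + -‖y‖ ^ 2 / 2 + infConvQuarter f y) := by
        simp only [Real.exp_add]
        ring
    _ ≤ A ^ 2 * Real.exp (2 * (-‖(2⁻¹ : ℝ) • (x + y)‖ ^ 2 / 2)) := by
        gcongr
        rw [hnorm]
        nlinarith
    _ = _ := by
        rw [two_mul, Real.exp_add]
        ring

/-- Non-symmetric "small ε" inequality: for every `C > 0` there is a constant `K`
depending only on `C` such that for every `ε ∈ (0,1]` and every (not necessarily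
even) `f ∈ F(C,ε)`, `E[e^{-f(X)}] E[e^{(f ⊡ c/4)(X)}] ≤ 1 + K ε³`. -/
theorem small_epsilon_inequality_quarter (C : ℝ) (hC : 0 < C) :
    ∃ K : ℝ, ∀ (d : ℕ) (ε : ℝ), ε ∈ Set.Ioc (0 : ℝ) 1 →
      ∀ f : EuclideanSpace ℝ (Fin d) → ℝ, memF C ε f →
        (∫⁻ x, ENNReal.ofReal (Real.exp (-f x)) ∂stdGauss d) *
          (∫⁻ x, ENNReal.ofReal (Real.exp (infConvQuarter f x)) ∂stdGauss d) ≤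
          ENNReal.ofReal (1 + K * ε ^ 3) := by
  refine ⟨0, fun d ε _ f hf => ?_⟩
  simpa using lintegral_exp_neg_mul_lintegral_exp_infConvQuarter_le_one hf.1
end

section
/- For every C > 0 there is a constant K₁ depending only on C such that: for every ε ∈ (0,1] and every f ∈ F(C,ε) with E f(X) = 0 (X a standard Gaussian vector on ℝ^d), one has E[e^{−f(X)}] ≤ 1 + ½ E[f(X)²] + K₁ ε³, and likewise E[e^{f(X)}] ≤ 1 + ½ E[f(X)²] + K₁ ε³. -/
open MeasureTheory Real

open ProbabilityTheory Filter Topology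

/-- The density definition agrees with Mathlib's standard Gaussian measure. -/
theorem stdGauss_eq_stdGaussian (d : ℕ) :
    stdGauss d = stdGaussian (EuclideanSpace ℝ (Fin d)) := by
  have hint : Integrable (fun x : EuclideanSpace ℝ (Fin d) =>
      (2 * π) ^ (-(d : ℝ) / 2) * Real.exp (-‖x‖ ^ 2 / 2)) := by
    refine Integrable.const_mul ?_ _
    have h := (GaussianFourier.integrable_cexp_neg_mul_sq_norm_add
      (b := 1 / 2) (by norm_num) 0 (0 : EuclideanSpace ℝ (Fin d))).norm
    refine h.congr (Eventually.of_forall fun x => ?_)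
    simp only [Complex.norm_exp]
    congr 1
    have hre : ((‖x‖ : ℂ) ^ 2).re = ‖x‖ ^ 2 := by rw [← Complex.ofReal_pow, Complex.ofReal_re]
    simp [Complex.mul_re, hre]
    ring
  have hfin : IsFiniteMeasure (stdGauss d) := isFiniteMeasure_withDensity_ofReal hint.2
  apply Measure.ext_of_charFun
  ext t
  have hpos : 0 ≤ 2 * π := by positivity
  rw [charFun_stdGaussian, charFun_apply, stdGauss,
    integral_withDensity_eq_integral_toReal_smul (by fun_prop)
      (Eventually.of_forall fun _ => ENNReal.ofReal_lt_top)]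
  have key := GaussianFourier.integral_cexp_neg_mul_sq_norm_add
      (b := 1 / 2) (by norm_num) Complex.I t
  have hrw : ∀ x : EuclideanSpace ℝ (Fin d),
      (ENNReal.ofReal ((2 * π) ^ (-(d : ℝ) / 2) * Real.exp (-‖x‖ ^ 2 / 2))).toReal •
        Complex.exp (inner ℝ x t * Complex.I) =
      (((2 * π) ^ (-(d : ℝ) / 2) : ℝ) : ℂ) *
        Complex.exp (-(1 / 2) * ‖x‖ ^ 2 + Complex.I * inner ℝ t x) := by
    intro x
    rw [ENNReal.toReal_ofReal (by positivity), Complex.real_smul, Complex.ofReal_mul, mul_assoc,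
      Complex.ofReal_exp, ← Complex.exp_add, real_inner_comm]
    congr 2
    push_cast
    ring
  simp_rw [hrw]
  rw [integral_const_mul, key, ← mul_assoc]
  have hconst : (((2 * π) ^ (-(d : ℝ) / 2) : ℝ) : ℂ) *
      ((π : ℂ) / (1 / 2)) ^ ((Module.finrank ℝ (EuclideanSpace ℝ (Fin d)) : ℂ) / 2) = 1 := by
    have h1 : ((π : ℂ) / (1 / 2)) = ((2 * π : ℝ) : ℂ) := by push_cast; ring
    have h2 : ((Module.finrank ℝ (EuclideanSpace ℝ (Fin d)) : ℂ) / 2) = (((d : ℝ) / 2 : ℝ) : ℂ) := by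
      simp
    rw [h1, h2, ← Complex.ofReal_cpow hpos, ← Complex.ofReal_mul,
      ← Real.rpow_add (by positivity)]
    norm_num [neg_div]
  rw [hconst, one_mul]
  congr 1
  rw [Complex.I_sq]
  ring

instance isGaussian_stdGauss (d : ℕ) : IsGaussian (stdGauss d) := by
  rw [stdGauss_eq_stdGaussian]
  infer_instance

theorem integrable_exp_mul_norm_stdGauss (d : ℕ) (a : ℝ) :
    Integrable (fun x => Real.exp (a * ‖x‖)) (stdGauss d) := by
  obtain ⟨c, hc, hint⟩ := IsGaussian.exists_integrable_exp_sq (stdGauss d)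
  refine (hint.const_mul (Real.exp (a ^ 2 / (4 * c)))).mono' (by fun_prop)
    (Eventually.of_forall fun x => ?_)
  rw [Real.norm_eq_abs, Real.abs_exp, ← Real.exp_add, Real.exp_le_exp]
  have h : a ^ 2 / (4 * c) + c * ‖x‖ ^ 2 - a * ‖x‖ = c * (‖x‖ - a / (2 * c)) ^ 2 := by
    field_simp
    ring
  have : 0 ≤ c * (‖x‖ - a / (2 * c)) ^ 2 := by positivity
  linarith

theorem integral_exp_strongDual_stdGauss (d : ℕ)
    (L : StrongDual ℝ (EuclideanSpace ℝ (Fin d))) :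
    ∫ y, Real.exp (L y) ∂stdGauss d = Real.exp (‖L‖ ^ 2 / 2) := by
  have h := mgf_gaussianReal (IsGaussian.map_eq_gaussianReal (μ := stdGauss d) L) 1
  simp only [mgf, one_mul] at h
  rw [h, stdGauss_eq_stdGaussian, integral_strongDual_stdGaussian, variance_dual_stdGaussian,
    Real.coe_toNNReal _ (by positivity)]
  congr 1
  ring

theorem LipschitzWith.le_add_mul_norm {E : Type*} [SeminormedAddCommGroup E] {K : NNReal}
    {g : E → ℝ} (hg : LipschitzWith K g) (x : E) : |g x| ≤ |g 0| + K * ‖x‖ := by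
  have h := hg.dist_le_mul x 0
  rw [Real.dist_eq, dist_zero_right] at h
  have h' := abs_sub_abs_le_abs_sub (g x) (g 0)
  linarith

theorem LipschitzWith.integrable_exp_stdGauss {d : ℕ} {K : NNReal}
    {g : EuclideanSpace ℝ (Fin d) → ℝ} (hg : LipschitzWith K g) :
    Integrable (fun x => Real.exp (g x)) (stdGauss d) := by
  have hcont := hg.continuous
  refine ((integrable_exp_mul_norm_stdGauss d K).const_mul (Real.exp |g 0|)).mono'
    (by fun_prop) (Eventually.of_forall fun x => ?_)
  rw [Real.norm_eq_abs, Real.abs_exp, ← Real.exp_add, Real.exp_le_exp]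
  exact (le_abs_self _).trans (hg.le_add_mul_norm x)

/-- The increment of a Lipschitz function along a rotation of small angle. -/
theorem LipschitzWith.abs_rotation_sub_le {E : Type*} [NormedAddCommGroup E] [NormedSpace ℝ E]
    {K : NNReal} {g : E → ℝ} (hg : LipschitzWith K g) (θ : ℝ) (x y : E) :
    |g (Real.cos θ • x + Real.sin θ • y) - g x| ≤ K * (|θ| * (‖x‖ + ‖y‖)) := by
  have h := hg.dist_le_mul (Real.cos θ • x + Real.sin θ • y) x
  rw [Real.dist_eq, dist_eq_norm] at h
  refine h.trans (mul_le_mul_of_nonneg_left ?_ K.2)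
  have e : Real.cos θ • x + Real.sin θ • y - x = (Real.cos θ - 1) • x + Real.sin θ • y := by
    module
  rw [e]
  refine (norm_add_le _ _).trans ?_
  rw [norm_smul, norm_smul, mul_add, Real.norm_eq_abs, Real.norm_eq_abs]
  have h1 := Real.abs_cos_sub_cos_le θ 0
  rw [Real.cos_zero, sub_zero] at h1
  exact add_le_add (mul_le_mul_of_nonneg_right h1 (norm_nonneg _))
    (mul_le_mul_of_nonneg_right Real.abs_sin_le_abs (norm_nonneg _))

theorem integrable_exp_mul_norm_add_norm_stdGauss (d : ℕ) (a : ℝ) :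
    Integrable (fun p => Real.exp (a * (‖p.1‖ + ‖p.2‖))) ((stdGauss d).prod (stdGauss d)) := by
  have h := (integrable_exp_mul_norm_stdGauss d a).mul_prod (integrable_exp_mul_norm_stdGauss d a)
  refine h.congr (Eventually.of_forall fun p => ?_)
  simp only [mul_add, Real.exp_add]

theorem LipschitzWith.integrable_exp_rotation_sub {d : ℕ} {K : NNReal}
    {g : EuclideanSpace ℝ (Fin d) → ℝ} (hg : LipschitzWith K g) (c θ : ℝ) :
    Integrable (fun p => Real.exp (c * (g (Real.cos θ • p.1 + Real.sin θ • p.2) - g p.1)))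
      ((stdGauss d).prod (stdGauss d)) := by
  have hcont := hg.continuous
  refine (integrable_exp_mul_norm_add_norm_stdGauss d (|c| * (K * |θ|))).mono'
    (by fun_prop) (Eventually.of_forall fun p => ?_)
  rw [Real.norm_eq_abs, Real.abs_exp, Real.exp_le_exp]
  refine (le_abs_self _).trans ?_
  rw [abs_mul, mul_assoc, mul_assoc]
  exact mul_le_mul_of_nonneg_left (hg.abs_rotation_sub_le θ _ _) (abs_nonneg _)

/-- Cutting the quarter turn from `x` to `y` into `n` equal rotations and using convexity of `exp`
together with rotation invariance. -/
theorem LipschitzWith.integral_exp_sub_le_rotation {d : ℕ} {K : NNReal}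
    {g : EuclideanSpace ℝ (Fin d) → ℝ} (hg : LipschitzWith K g) {n : ℕ} (hn : 0 < n) :
    ∫ p, Real.exp (g p.2 - g p.1) ∂((stdGauss d).prod (stdGauss d)) ≤
      ∫ p, Real.exp (n * (g (Real.cos (π / 2 / n) • p.1 + Real.sin (π / 2 / n) • p.2) - g p.1))
        ∂((stdGauss d).prod (stdGauss d)) := by
  set δ : ℝ := π / 2 / n with hδ
  set ν := (stdGauss d).prod (stdGauss d)
  have hn' : (n : ℝ) ≠ 0 := by positivity
  set F : EuclideanSpace ℝ (Fin d) × EuclideanSpace ℝ (Fin d) → ℝ := fun p =>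
    Real.exp (n * (g (Real.cos δ • p.1 + Real.sin δ • p.2) - g p.1)) with hF
  have hFint : Integrable F ν := hg.integrable_exp_rotation_sub n δ
  have hrot : ∀ θ : ℝ, MeasurePreserving (ContinuousLinearMap.rotation θ) ν ν := fun θ =>
    ⟨by fun_prop, IsGaussian.map_rotation_eq_self
      (by simp [stdGauss_eq_stdGaussian]) θ⟩
  have hmeasF : AEStronglyMeasurable F ν := hFint.1
  have hFrot : ∀ k : ℕ, ∫ p, F (ContinuousLinearMap.rotation (k * δ) p) ∂ν = ∫ p, F p ∂ν := by
    intro k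
    have h := integral_map (hrot (k * δ)).aemeasurable (f := F)
      (by rw [(hrot (k * δ)).map_eq]; exact hmeasF)
    rw [(hrot (k * δ)).map_eq] at h
    exact h.symm
  have hFrotint : ∀ k : ℕ, Integrable (fun p => F (ContinuousLinearMap.rotation (k * δ) p)) ν :=
    fun k => (hrot (k * δ)).integrable_comp_of_integrable hFint
  have hpt : ∀ p, Real.exp (g p.2 - g p.1) ≤
      ∑ k ∈ Finset.range n, (1 / n : ℝ) * F (ContinuousLinearMap.rotation (k * δ) p) := by
    intro p
    let u : ℕ → ℝ := fun k => g (Real.cos (k * δ) • p.1 + Real.sin (k * δ) • p.2)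
    have hstep : ∀ k : ℕ, F (ContinuousLinearMap.rotation (k * δ) p) =
        Real.exp (n * (u (k + 1) - u k)) := by
      intro k
      simp only [hF, u, ContinuousLinearMap.rotation_apply]
      congr 4
      push_cast
      rw [add_mul, one_mul, Real.cos_add, Real.sin_add]
      module
    have hsum : g p.2 - g p.1 =
        ∑ k ∈ Finset.range n, (1 / n : ℝ) • (n * (u (k + 1) - u k)) := by
      have : ∀ k, (1 / n : ℝ) • (n * (u (k + 1) - u k)) = u (k + 1) - u k := fun k => by
        rw [smul_eq_mul]
        field_simp
      simp_rw [this]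
      rw [Finset.sum_range_sub]
      have e : (n : ℝ) * δ = π / 2 := by rw [hδ]; field_simp
      simp [u, e]
    rw [hsum]
    simp_rw [hstep]
    exact convexOn_exp.map_sum_le (fun _ _ => by positivity) (by simp [hn']) (fun _ _ => trivial)
  have hle : ∫ p, Real.exp (g p.2 - g p.1) ∂ν ≤
      ∫ p, ∑ k ∈ Finset.range n, (1 / n : ℝ) * F (ContinuousLinearMap.rotation (k * δ) p) ∂ν :=
    integral_mono_of_nonneg (Eventually.of_forall fun _ => (Real.exp_pos _).le)
      (integrable_finsetSum _ fun k _ => (hFrotint k).const_mul _) (Eventually.of_forall hpt)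
  refine hle.trans (le_of_eq ?_)
  rw [integral_finsetSum _ fun k _ => (hFrotint k).const_mul _]
  simp_rw [integral_const_mul, hFrot]
  rw [Finset.sum_const, Finset.card_range, nsmul_eq_mul]
  field_simp

theorem DifferentiableAt.tendsto_mul_rotation_sub {E : Type*} [NormedAddCommGroup E]
    [NormedSpace ℝ E] {g : E → ℝ} {x : E} (hg : DifferentiableAt ℝ g x) (y : E) :
    Tendsto (fun n : ℕ =>
      (n : ℝ) * (g (Real.cos (π / 2 / n) • x + Real.sin (π / 2 / n) • y) - g x))
      atTop (𝓝 (π / 2 * fderiv ℝ g x y)) := by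
  have hc : HasDerivAt (fun t : ℝ => Real.cos t • x + Real.sin t • y) y 0 := by
    convert! ((Real.hasDerivAt_cos 0).smul_const x).add ((Real.hasDerivAt_sin 0).smul_const y)
      using 1
    simp
  have hd : HasDerivAt (fun t : ℝ => g (Real.cos t • x + Real.sin t • y)) (fderiv ℝ g x y) 0 := by
    have hx : HasFDerivAt g (fderiv ℝ g x) (Real.cos 0 • x + Real.sin 0 • y) := by
      simpa using hg.hasFDerivAt
    exact hx.comp_hasDerivAt 0 hc
  have hδ : Tendsto (fun n : ℕ => π / 2 / (n : ℝ)) atTop (𝓝[≠] 0) := by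
    refine tendsto_nhdsWithin_iff.2 ⟨tendsto_const_div_atTop_nhds_zero_nat _, ?_⟩
    filter_upwards [eventually_gt_atTop 0] with n hn
    have : (0 : ℝ) < n := by exact_mod_cast hn
    have : 0 < π / 2 / n := by positivity
    exact this.ne'
  refine ((hd.tendsto_slope.comp hδ).const_mul (π / 2)).congr' ?_
  filter_upwards [eventually_gt_atTop 0] with n hn
  have : (0 : ℝ) < n := by exact_mod_cast hn
  simp only [Function.comp_apply, slope_def_field, Real.cos_zero, Real.sin_zero, one_smul,
    zero_smul, add_zero, sub_zero]
  field_simp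

/-- **Maurey–Pisier inequality** for Lipschitz functions of a Gaussian vector. -/
theorem LipschitzWith.integral_exp_sub_le {d : ℕ} {K : NNReal}
    {g : EuclideanSpace ℝ (Fin d) → ℝ} (hg : LipschitzWith K g) :
    ∫ p, Real.exp (g p.2 - g p.1) ∂((stdGauss d).prod (stdGauss d)) ≤
      Real.exp ((π / 2 * K) ^ 2 / 2) := by
  have hcont := hg.continuous
  have hdiff : ∀ᵐ x ∂stdGauss d, DifferentiableAt ℝ g x :=
    (withDensity_absolutelyContinuous _ _).ae_le hg.ae_differentiableAt
  have hlim := tendsto_integral_of_dominated_convergence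
    (μ := (stdGauss d).prod (stdGauss d))
    (F := fun (n : ℕ) p => Real.exp
      (n * (g (Real.cos (π / 2 / n) • p.1 + Real.sin (π / 2 / n) • p.2) - g p.1)))
    (f := fun p => Real.exp (π / 2 * fderiv ℝ g p.1 p.2))
    (fun p => Real.exp (K * (π / 2) * (‖p.1‖ + ‖p.2‖)))
    (fun n => by fun_prop) (integrable_exp_mul_norm_add_norm_stdGauss d _)
    (fun n => Eventually.of_forall fun p => by
      rw [Real.norm_eq_abs, Real.abs_exp, Real.exp_le_exp]
      rcases Nat.eq_zero_or_pos n with rfl | hn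
      · simp only [Nat.cast_zero, zero_mul]
        positivity
      have hn' : (0 : ℝ) < n := by exact_mod_cast hn
      have h := (le_abs_self _).trans (hg.abs_rotation_sub_le (π / 2 / n) p.1 p.2)
      rw [abs_of_pos (by positivity)] at h
      refine (mul_le_mul_of_nonneg_left h hn'.le).trans (le_of_eq ?_)
      field_simp)
    (by
      filter_upwards [Measure.quasiMeasurePreserving_fst.ae hdiff] with p hp
      exact (Real.continuous_exp.tendsto _).comp (hp.tendsto_mul_rotation_sub p.2))
  refine (ge_of_tendsto hlim ?_).trans ?_
  · filter_upwards [eventually_gt_atTop 0] with n hn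
    exact hg.integral_exp_sub_le_rotation hn
  have hbound : ∀ x : EuclideanSpace ℝ (Fin d), ‖(π / 2) • fderiv ℝ g x‖ ≤ π / 2 * K := fun x => by
    rw [norm_smul, Real.norm_of_nonneg (by positivity)]
    exact mul_le_mul_of_nonneg_left (norm_fderiv_le_of_lipschitz ℝ hg) (by positivity)
  have hmeas : Measurable fun p : EuclideanSpace ℝ (Fin d) × EuclideanSpace ℝ (Fin d) =>
      Real.exp (π / 2 * fderiv ℝ g p.1 p.2) := by
    have : Measurable fun p : EuclideanSpace ℝ (Fin d) × EuclideanSpace ℝ (Fin d) =>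
        fderiv ℝ g p.1 p.2 :=
      ContinuousLinearMap.measurable_apply₂.comp
        (((measurable_fderiv ℝ g).comp measurable_fst).prodMk measurable_snd)
    fun_prop
  have hint : Integrable (fun p => Real.exp (π / 2 * fderiv ℝ g p.1 p.2))
      ((stdGauss d).prod (stdGauss d)) := by
    refine (integrable_exp_mul_norm_add_norm_stdGauss d (π / 2 * K)).mono'
      hmeas.aestronglyMeasurable (Eventually.of_forall fun p => ?_)
    rw [Real.norm_eq_abs, Real.abs_exp, Real.exp_le_exp]
    have h := ((π / 2) • fderiv ℝ g p.1).le_of_opNorm_le (hbound p.1) p.2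
    refine (le_abs_self _).trans (h.trans ?_)
    have := norm_nonneg p.1
    gcongr
    linarith
  rw [integral_prod _ hint]
  have hinner : ∀ x, ∫ y, Real.exp (π / 2 * fderiv ℝ g x y) ∂stdGauss d ≤
      Real.exp ((π / 2 * K) ^ 2 / 2) := fun x => by
    have h := integral_exp_strongDual_stdGauss d ((π / 2) • fderiv ℝ g x)
    simp only [smul_apply, smul_eq_mul] at h
    rw [h, Real.exp_le_exp]
    have := hbound x
    gcongr
  refine (integral_mono hint.integral_prod_left (integrable_const _) hinner).trans ?_
  simp

theorem LipschitzWith.integrable_stdGauss {d : ℕ} {K : NNReal}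
    {g : EuclideanSpace ℝ (Fin d) → ℝ} (hg : LipschitzWith K g) :
    Integrable g (stdGauss d) := by
  have hcont := hg.continuous
  refine (hg.integrable_exp_stdGauss.add hg.neg.integrable_exp_stdGauss).mono' (by fun_prop)
    (Eventually.of_forall fun x => ?_)
  simp only [Pi.add_apply, Pi.neg_apply, Real.norm_eq_abs]
  have h1 := Real.add_one_le_exp (g x)
  have h2 := Real.add_one_le_exp (-g x)
  have h3 := Real.exp_pos (g x)
  have h4 := Real.exp_pos (-g x)
  rw [abs_le]
  constructor <;> linarith

/-- Dimension-free exponential moment bound for mean-zero Lipschitz functions. -/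
theorem LipschitzWith.integral_exp_le_of_integral_eq_zero {d : ℕ} {K : NNReal}
    {g : EuclideanSpace ℝ (Fin d) → ℝ} (hg : LipschitzWith K g)
    (hmean : ∫ x, g x ∂stdGauss d = 0) :
    ∫ x, Real.exp (g x) ∂stdGauss d ≤ Real.exp ((π / 2 * K) ^ 2 / 2) := by
  have hneg : Integrable (fun x => Real.exp (-g x)) (stdGauss d) := hg.neg.integrable_exp_stdGauss
  have hone : 1 ≤ ∫ x, Real.exp (-g x) ∂stdGauss d := by
    have hi : Integrable (fun x => -g x + 1) (stdGauss d) :=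
      hg.integrable_stdGauss.neg.add (integrable_const _)
    have h := integral_mono hi hneg fun x => Real.add_one_le_exp (-g x)
    rw [integral_add (f := fun x => -g x) hg.integrable_stdGauss.neg (integrable_const _),
      integral_neg, hmean] at h
    simpa using h
  have hprod := integral_prod_mul (μ := stdGauss d) (ν := stdGauss d)
    (fun x => Real.exp (-g x)) (fun y => Real.exp (g y))
  have hle := hg.integral_exp_sub_le
  have e : ∀ p : EuclideanSpace ℝ (Fin d) × EuclideanSpace ℝ (Fin d),
      Real.exp (g p.2 - g p.1) = Real.exp (-g p.1) * Real.exp (g p.2) := fun p => by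
    rw [← Real.exp_add]
    ring_nf
  simp_rw [e] at hle
  rw [hprod] at hle
  have hpos : 0 ≤ ∫ x, Real.exp (g x) ∂stdGauss d := integral_nonneg fun x => (Real.exp_pos _).le
  nlinarith

theorem Real.exp_le_taylor_two_add (t : ℝ) :
    Real.exp t ≤ 1 + t + t ^ 2 / 2 + |t| ^ 3 * Real.exp |t| := by
  have h := Complex.norm_exp_sub_sum_le_norm_mul_exp (t : ℂ) 3
  have e : Complex.exp t - ∑ m ∈ Finset.range 3, (t : ℂ) ^ m / m.factorial =
      ((Real.exp t - (1 + t + t ^ 2 / 2) : ℝ) : ℂ) := by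
    simp [Finset.sum_range_succ]
  rw [e, Complex.norm_real, Complex.norm_real, Real.norm_eq_abs, Real.norm_eq_abs] at h
  have := (le_abs_self _).trans h
  linarith

theorem Real.abs_pow_three_mul_exp_abs_le (s : ℝ) :
    |s| ^ 3 * Real.exp |s| ≤ 6 * (Real.exp (2 * s) + Real.exp (-(2 * s))) := by
  have h := Real.pow_div_factorial_le_exp |s| (abs_nonneg s) 3
  have h3 : |s| ^ 3 ≤ 6 * Real.exp |s| := by
    norm_num [Nat.factorial] at h
    linarith
  have h2 : Real.exp |s| * Real.exp |s| ≤ Real.exp (2 * s) + Real.exp (-(2 * s)) := by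
    rw [← Real.exp_add, ← two_mul]
    have h4 := Real.exp_pos (2 * s)
    have h5 := Real.exp_pos (-(2 * s))
    rcases abs_choice s with hs | hs <;> rw [hs]
    · linarith
    · rw [mul_neg]
      linarith
  nlinarith [Real.exp_pos |s|]

/-- Second-order expansion of the exponential moment of `ε • g` with `g` Lipschitz and centred. -/
theorem LipschitzWith.integral_exp_mul_le {d : ℕ} {K : NNReal}
    {g : EuclideanSpace ℝ (Fin d) → ℝ} (hg : LipschitzWith K g)
    (hmean : ∫ x, g x ∂stdGauss d = 0) {ε : ℝ} (hε : 0 ≤ ε) (hε1 : ε ≤ 1) :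
    ∫ x, Real.exp (ε * g x) ∂stdGauss d ≤ 1 + (∫ x, (ε * g x) ^ 2 ∂stdGauss d) / 2 +
      12 * Real.exp ((π / 2 * (2 * K)) ^ 2 / 2) * ε ^ 3 := by
  have hcont := hg.continuous
  have h2 : LipschitzWith (2 * K) (fun x => 2 * g x) := by
    have h := (lipschitzWith_smul (2 : ℝ)).comp hg
    rw [Real.nnnorm_ofNat] at h
    exact h
  have hn2 : LipschitzWith (2 * K) (fun x => -(2 * g x)) := h2.neg
  have hb1 := h2.integral_exp_le_of_integral_eq_zero (by rw [integral_const_mul, hmean, mul_zero])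
  have hb2 := hn2.integral_exp_le_of_integral_eq_zero
    (by rw [integral_neg, integral_const_mul, hmean, mul_zero, neg_zero])
  push_cast at hb1 hb2
  have hi := h2.integrable_exp_stdGauss.add hn2.integrable_exp_stdGauss
  have hsq : Integrable (fun x => (ε * g x) ^ 2) (stdGauss d) := by
    refine (hi.const_mul (ε ^ 2)).mono' (by fun_prop) (Eventually.of_forall fun x => ?_)
    rw [Real.norm_of_nonneg (by positivity), mul_pow]
    refine mul_le_mul_of_nonneg_left ?_ (by positivity)
    have h := Real.quadratic_le_exp_of_nonneg (abs_nonneg (2 * g x))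
    have h' : Real.exp |2 * g x| ≤ Real.exp (2 * g x) + Real.exp (-(2 * g x)) :=
      Real.exp_abs_le _
    have h'' : |2 * g x| ^ 2 = 4 * g x ^ 2 := by rw [sq_abs]; ring
    simp only [Pi.add_apply]
    nlinarith [abs_nonneg (2 * g x), sq_nonneg (g x)]
  have hlin : Integrable (fun x => 1 + ε * g x) (stdGauss d) :=
    (integrable_const _).add (hg.integrable_stdGauss.const_mul ε)
  have hquad : Integrable (fun x => 1 + ε * g x + (ε * g x) ^ 2 / 2) (stdGauss d) :=
    hlin.add (hsq.div_const 2)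
  have hrem : Integrable (fun x => ε ^ 3 * (6 * (Real.exp (2 * g x) + Real.exp (-(2 * g x)))))
      (stdGauss d) := (hi.const_mul 6).const_mul _
  have hpt : ∀ x, Real.exp (ε * g x) ≤ 1 + ε * g x + (ε * g x) ^ 2 / 2 +
      ε ^ 3 * (6 * (Real.exp (2 * g x) + Real.exp (-(2 * g x)))) := fun x => by
    refine (Real.exp_le_taylor_two_add _).trans (add_le_add le_rfl ?_)
    rw [abs_mul, abs_of_nonneg hε, mul_pow, mul_assoc]
    refine mul_le_mul_of_nonneg_left (le_trans ?_ (Real.abs_pow_three_mul_exp_abs_le (g x)))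
      (by positivity)
    gcongr
    exact mul_le_of_le_one_left (abs_nonneg _) hε1
  have hle := integral_mono_of_nonneg (μ := stdGauss d)
    (Eventually.of_forall fun x => (Real.exp_pos (ε * g x)).le)
    (hquad.add hrem) (Eventually.of_forall hpt)
  refine hle.trans ?_
  rw [integral_add' hquad hrem, integral_add hlin (hsq.div_const 2),
    integral_add (integrable_const _) (hg.integrable_stdGauss.const_mul ε), integral_const_mul,
    hmean, integral_const_mul, integral_const_mul, integral_div,
    integral_add h2.integrable_exp_stdGauss hn2.integrable_exp_stdGauss]
  simp only [integral_const, probReal_univ, smul_eq_mul, mul_one, mul_zero, add_zero]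
  have h3 : 0 ≤ ε ^ 3 := by positivity
  nlinarith

/-- Taylor-expansion moment bounds: for every `C > 0` there is a constant `K₁`
depending only on `C` such that for every `ε ∈ (0,1]` and every mean-zero
`f ∈ F(C,ε)`, `E[e^{-f(X)}] ≤ 1 + ½E[f(X)²] + K₁ε³` and
`E[e^{f(X)}] ≤ 1 + ½E[f(X)²] + K₁ε³`. -/
theorem exp_moment_bounds (C : ℝ) (hC : 0 < C) :
    ∃ K₁ : ℝ, ∀ (d : ℕ) (ε : ℝ), ε ∈ Set.Ioc (0 : ℝ) 1 →
      ∀ f : EuclideanSpace ℝ (Fin d) → ℝ, memF C ε f →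
        (∫ x, f x ∂stdGauss d) = 0 →
        (∫ x, Real.exp (-f x) ∂stdGauss d ≤
            1 + (∫ x, f x ^ 2 ∂stdGauss d) / 2 + K₁ * ε ^ 3) ∧
        (∫ x, Real.exp (f x) ∂stdGauss d ≤
            1 + (∫ x, f x ^ 2 ∂stdGauss d) / 2 + K₁ * ε ^ 3) := by
  refine ⟨12 * Real.exp ((π / 2 * (2 * C)) ^ 2 / 2), fun d ε hε f hf hmean => ?_⟩
  obtain ⟨hε0, hε1⟩ := hε
  have hCpos : ((C.toNNReal : NNReal) : ℝ) = C := Real.coe_toNNReal _ hC.le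
  have hg : LipschitzWith C.toNNReal (fun x => f x / ε) := by
    refine LipschitzWith.of_dist_le_mul fun x y => ?_
    have h := hf.1.dist_le_mul x y
    rw [Real.coe_toNNReal _ (by positivity)] at h
    rw [Real.dist_eq] at h ⊢
    rw [hCpos, ← sub_div, abs_div, abs_of_pos hε0, div_le_iff₀ hε0]
    linarith
  have hgmean : ∫ x, f x / ε ∂stdGauss d = 0 := by rw [integral_div, hmean, zero_div]
  have hmul : ∀ x, ε * (f x / ε) = f x := fun x => by field_simp
  have hnmul : ∀ x, ε * -(f x / ε) = -f x := fun x => by field_simp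
  have hpos := hg.integral_exp_mul_le hgmean hε0.le hε1
  have hneg := LipschitzWith.integral_exp_mul_le (g := fun x => -(f x / ε)) hg.neg
    (by rw [integral_neg, hgmean, neg_zero]) hε0.le hε1
  simp_rw [hmul, hCpos] at hpos
  simp_rw [hnmul, hCpos, neg_sq] at hneg
  exact ⟨hneg, hpos⟩
end
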